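/- arXiv:0904.2944 — 2 statements merged into one kernel-verified Lean document; each statement's English description precedes it below -/
import Mathlib

section
/- Let (f, τ, c) be degree −2 branched covering data with f confluent, and let X ⊆ ℂ be an indecomposable continuum with f(X) = X. If Z is an internal composant of X, then f(Z) is an internal composant of X. -/
open Set Topology

/-- A continuum: a nonempty compact connected subset of ℂ. -/
def IsContinuum (K : Set ℂ) : Prop := IsCompact K ∧ IsConnected K

/-- An indecomposable continuum: non-degenerate and not the union of two
proper subcontinua. -/
def IndecomposableC (X : Set ℂ) : Prop :=
  IsContinuum X ∧ X.Nontrivial ∧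
    ¬ ∃ A B : Set ℂ, IsContinuum A ∧ IsContinuum B ∧ A ⊆ X ∧ B ⊆ X ∧
      A ≠ X ∧ B ≠ X ∧ A ∪ B = X

/-- The composant of a point `x` in `X`: the union of all proper subcontinua
of `X` containing `x`. -/
def Composant (X : Set ℂ) (x : ℂ) : Set ℂ :=
  ⋃₀ {P : Set ℂ | IsContinuum P ∧ P ⊆ X ∧ P ≠ X ∧ x ∈ P}

/-- `Z` is a composant of `X`. -/
def IsComposant (X Z : Set ℂ) : Prop := ∃ x ∈ X, Z = Composant X x

/-- An internal composant: every continuum meeting both `ℂ \ X` and `Z`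
intersects all composants of `X`. -/
def IsInternalComposant (X Z : Set ℂ) : Prop :=
  IsComposant X Z ∧
    ∀ L : Set ℂ, IsContinuum L → (L ∩ Xᶜ).Nonempty → (L ∩ Z).Nonempty →
      ∀ W : Set ℂ, IsComposant X W → (L ∩ W).Nonempty

/-- `C` is a connected component of the set `S`. -/
def IsComponentOf (C S : Set ℂ) : Prop := ∃ x ∈ S, C = connectedComponentIn S x

/-- A confluent map: each component of the preimage of a continuum maps onto it. -/
def Confluent (f : ℂ → ℂ) : Prop :=
  ∀ K C : Set ℂ, IsContinuum K → IsComponentOf C (f ⁻¹' K) → f '' C = K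

theorem aux_conn {A B X K : Set ℂ} (hA : IsClosed A) (hB : IsClosed B) (hAB : A ∩ B ⊆ K)
    (hKA : K ⊆ A) (hU : A ∪ B = X) (hX : IsPreconnected X) (hK : IsConnected K) :
    IsPreconnected A := by
  have key : ∀ F G : Set ℂ, IsClosed F → IsClosed G → A ⊆ F ∪ G → Disjoint F G → K ⊆ F → A ⊆ F := by
    intro F G hF hG hAFG hd hKF
    have hXc := hX
    rw [isPreconnected_closed_iff] at hXc
    by_contra hn
    obtain ⟨a, haA, haF⟩ := not_subset.1 hn
    obtain ⟨k, hk⟩ := hK.nonempty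
    have haG : a ∈ G := (hAFG haA).resolve_left haF
    obtain ⟨y, -, hy1, hy2⟩ := hXc ((A ∩ F) ∪ B) (A ∩ G) ((hA.inter hF).union hB) (hA.inter hG)
      (by
        intro z hz
        rw [← hU] at hz
        rcases hz with hz | hz
        · rcases hAFG hz with h | h
          · exact Or.inl (Or.inl ⟨hz, h⟩)
          · exact Or.inr ⟨hz, h⟩
        · exact Or.inl (Or.inr hz))
      ⟨k, hU ▸ Or.inl (hKA hk), Or.inl ⟨hKA hk, hKF hk⟩⟩
      ⟨a, hU ▸ Or.inl haA, haA, haG⟩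
    have hyF : y ∈ F := by
      rcases hy1 with h | h
      · exact h.2
      · exact hKF (hAB ⟨hy2.1, h⟩)
    exact disjoint_left.1 hd hyF hy2.2
  rw [isPreconnected_iff_subset_of_fully_disjoint_closed hA]
  intro F G hF hG hAFG hd
  have := (isPreconnected_iff_subset_of_disjoint_closed.1 hK.isPreconnected) F G hF hG
    (hKA.trans hAFG) (by rw [hd.inter_eq, inter_empty])
  rcases this with h | h
  · exact Or.inl (key F G hF hG hAFG hd h)
  · exact Or.inr (key G F hG hF (by rwa [union_comm]) hd.symm h)

theorem aux_dense {X K : Set ℂ} (hX : IndecomposableC X) (hK : IsContinuum K) (hKX : K ⊆ X)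
    (hne : K ≠ X) : X ⊆ closure (X \ K) := by
  obtain ⟨⟨hXc, hXconn⟩, -, hind⟩ := hX
  by_contra hn
  apply hind
  by_cases hp : IsPreconnected (X \ K)
  · have hnon : (X \ K).Nonempty := by
      by_contra h
      exact hne (hKX.antisymm (sdiff_eq_empty.1 (not_nonempty_iff_eq_empty.1 h)))
    have hsub : closure (X \ K) ⊆ X := closure_minimal sdiff_subset hXc.isClosed
    refine ⟨K, closure (X \ K), hK, ⟨hXc.of_isClosed_subset isClosed_closure hsub,
      hnon.closure, hp.closure⟩, hKX, hsub, hne, fun h => hn h.ge, ?_⟩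
    apply (union_subset hKX hsub).antisymm
    intro z hz
    by_cases hzK : z ∈ K
    · exact Or.inl hzK
    · exact Or.inr (subset_closure ⟨hz, hzK⟩)
  · unfold IsPreconnected at hp
    push Not at hp
    obtain ⟨u, v, hu, hv, hcov, ⟨p, hpX, hpu⟩, ⟨q, hqX, hqv⟩, hemp⟩ := hp
    have hdis : ∀ z ∈ X, z ∉ K → z ∈ u → z ∈ v → False := by
      intro z h1 h2 h3 h4
      have : z ∈ (X \ K) ∩ (u ∩ v) := ⟨⟨h1, h2⟩, h3, h4⟩
      rw [hemp] at this
      exact this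
    have cA : IsClosed (K ∪ (X \ v)) := hK.1.isClosed.union (hXc.diff hv).isClosed
    have cB : IsClosed (K ∪ (X \ u)) := hK.1.isClosed.union (hXc.diff hu).isClosed
    have hI : (K ∪ (X \ v)) ∩ (K ∪ (X \ u)) ⊆ K := by
      rintro z ⟨h1 | h1, h2 | h2⟩
      · exact h1
      · exact h1
      · exact h2
      · by_contra hz
        rcases hcov ⟨h1.1, hz⟩ with h | h
        · exact h2.2 h
        · exact h1.2 h
    have hUn : (K ∪ (X \ v)) ∪ (K ∪ (X \ u)) = X := by
      apply (union_subset (union_subset hKX sdiff_subset) (union_subset hKX sdiff_subset)).antisymm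
      intro z hz
      by_cases hzK : z ∈ K
      · exact Or.inl (Or.inl hzK)
      · by_cases hzv : z ∈ v
        · exact Or.inr (Or.inr ⟨hz, fun h => hdis z hz hzK h hzv⟩)
        · exact Or.inl (Or.inr ⟨hz, hzv⟩)
    refine ⟨_, _, ⟨hK.1.union (hXc.diff hv), hK.2.nonempty.mono subset_union_left,
      aux_conn cA cB hI subset_union_left hUn hXconn.isPreconnected hK.2⟩,
      ⟨hK.1.union (hXc.diff hu), hK.2.nonempty.mono subset_union_left,
      aux_conn cB cA (by rwa [inter_comm]) subset_union_left (by rwa [union_comm])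
        hXconn.isPreconnected hK.2⟩, union_subset hKX sdiff_subset, union_subset hKX sdiff_subset,
      ?_, ?_, hUn⟩
    · intro h
      have := hqX.1
      rw [← h] at this
      rcases this with h | h
      · exact hqX.2 h
      · exact h.2 hqv
    · intro h
      have := hpX.1
      rw [← h] at this
      rcases this with h | h
      · exact hpX.2 h
      · exact h.2 hpu

theorem aux_component {S : Set ℂ} {x : ℂ} (hS : IsCompact S) (hx : x ∈ S) :
    IsContinuum (connectedComponentIn S x) := by
  refine ⟨hS.of_isClosed_subset ?_ (connectedComponentIn_subset S x),
    isConnected_connectedComponentIn_iff.2 hx⟩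
  have h1 : closure (connectedComponentIn S x) ⊆ connectedComponentIn S x :=
    isPreconnected_connectedComponentIn.closure.subset_connectedComponentIn
      (subset_closure (mem_connectedComponentIn hx))
      (closure_minimal (connectedComponentIn_subset S x) hS.isClosed)
  exact isClosed_of_closure_subset h1

theorem aux_baire {X : Set ℂ} (hX : IndecomposableC X) (x : ℂ) (hx : x ∈ X) :
    ¬ X ⊆ Composant X x := by
  intro hsub
  have hXc := hX.1.1
  let I := {U : Set ℂ // U ∈ TopologicalSpace.countableBasis ℂ ∧ x ∉ U ∧ (U ∩ X).Nonempty}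
  have hcI : Countable I :=
    ((TopologicalSpace.countable_countableBasis ℂ).mono
      (fun U (hU : U ∈ TopologicalSpace.countableBasis ℂ ∧ x ∉ U ∧ (U ∩ X).Nonempty) =>
        hU.1)).to_subtype
  let K : I → Set ℂ := fun U => connectedComponentIn (X \ U.1) x
  have hop : ∀ U : I, IsOpen U.1 := fun U => TopologicalSpace.isOpen_of_mem_countableBasis U.2.1
  have hK : ∀ U, IsContinuum (K U) := fun U => aux_component (hXc.diff (hop U)) ⟨hx, U.2.2.1⟩
  have hKX : ∀ U, K U ⊆ X := fun U => (connectedComponentIn_subset _ _).trans sdiff_subset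
  have hKne : ∀ U, K U ≠ X := by
    intro U h
    obtain ⟨z, hzU, hzX⟩ := U.2.2.2
    rw [← h] at hzX
    exact (connectedComponentIn_subset _ _ hzX).2 hzU
  have hcov : ∀ z ∈ X, ∃ U, z ∈ K U := by
    intro z hz
    obtain ⟨P, ⟨hP, hPX, hPne, hxP⟩, hzP⟩ := hsub hz
    obtain ⟨w, hwX, hwP⟩ := not_subset.1 (fun h => hPne (hPX.antisymm h))
    obtain ⟨U, hU, hwU, hUP⟩ := (TopologicalSpace.isBasis_countableBasis ℂ).exists_subset_of_mem_open
      (show w ∈ Pᶜ from hwP) hP.1.isClosed.isOpen_compl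
    refine ⟨⟨U, hU, fun h => hUP h hxP, ⟨w, hwU, hwX⟩⟩, ?_⟩
    exact hP.2.isPreconnected.subset_connectedComponentIn hxP
      (show P ⊆ X \ U from fun y hy => ⟨hPX hy, fun h => hUP h hy⟩) hzP
  have : CompactSpace X := isCompact_iff_compactSpace.1 hXc
  have : Nonempty X := ⟨⟨x, hx⟩⟩
  obtain ⟨U, hint⟩ := nonempty_interior_of_iUnion_of_closed
    (f := fun U : I => ((↑) : X → ℂ) ⁻¹' (K U))
    (fun U => (hK U).1.isClosed.preimage continuous_subtype_val)
    (by
      rw [eq_univ_iff_forall]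
      intro z
      obtain ⟨U, hU⟩ := hcov z z.2
      exact mem_iUnion.2 ⟨U, hU⟩)
  obtain ⟨z, hz⟩ := hint
  obtain ⟨O, hOs, hO, hzO⟩ := mem_interior.1 hz
  obtain ⟨V, hV, rfl⟩ := isOpen_induced_iff.1 hO
  obtain ⟨y, hyV, hyX, hyK⟩ := mem_closure_iff.1
    (aux_dense hX (hK U) (hKX U) (hKne U) z.2) V hV hzO
  exact hyK (hOs (show (⟨y, hyX⟩ : X) ∈ _ from hyV))

theorem image_of_internal_composant_is_internal
    (f τ : ℂ → ℂ) (c : ℂ)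
    (hf : Continuous f) (hopen : IsOpenMap f)
    (hperfect : ∀ K : Set ℂ, IsCompact K → IsCompact (f ⁻¹' K))
    (hτ : Continuous τ) (hττ : ∀ x, τ (τ x) = x) (hfτ : ∀ x, f (τ x) = f x)
    (hfib : ∀ x y, f x = f y → y = x ∨ y = τ x)
    (hc : τ c = c) (hcuniq : ∀ x, τ x = x → x = c)
    (hconf : Confluent f)
    (X : Set ℂ) (hX : IndecomposableC X) (hfX : f '' X = X)
    (Z : Set ℂ) (hZ : IsInternalComposant X Z) :
    IsInternalComposant X (f '' Z) := by
  obtain ⟨⟨x, hx, rfl⟩, hint⟩ := hZ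
  have hXc := hX.1.1
  have hmaps : ∀ z ∈ X, f z ∈ X := fun z hz => hfX ▸ mem_image_of_mem f hz
  have hproper : ∀ P, IsContinuum P → P ⊆ X → P ≠ X → f '' P ≠ X := by
    intro P hP hPX hPne h
    have h1 : X ⊆ τ '' P := by
      refine (aux_dense hX hP hPX hPne).trans
        (closure_minimal ?_ (hP.1.image hτ).isClosed)
      rintro z ⟨hz, hzP⟩
      have := hmaps z hz
      rw [← h] at this
      obtain ⟨p, hp, hpz⟩ := this
      rcases hfib p z hpz with e | e
      · exact absurd (e ▸ hp) hzP
      · exact ⟨p, hp, e.symm⟩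
    have h2 : ∀ z ∈ X, τ z ∈ P := by
      intro z hz
      obtain ⟨p, hp, rfl⟩ := h1 hz
      rw [hττ]
      exact hp
    apply hPne (hPX.antisymm _)
    intro z hz
    have := h2 _ (hPX (h2 z hz))
    rwa [hττ] at this
  have himg : ∀ w, f '' Composant X w ⊆ Composant X (f w) := by
    rintro w _ ⟨z, ⟨P, ⟨hP, hPX, hPne, hwP⟩, hzP⟩, rfl⟩
    exact ⟨f '' P, ⟨⟨hP.1.image hf, hP.2.image f hf.continuousOn⟩,
      (image_mono hPX).trans hfX.le, hproper P hP hPX hPne, mem_image_of_mem f hwP⟩,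
      mem_image_of_mem f hzP⟩
  have hself : ∀ w ∈ X, w ∈ Composant X w := by
    intro w hw
    refine ⟨{w}, ⟨⟨isCompact_singleton, isConnected_singleton⟩, singleton_subset_iff.2 hw, ?_, rfl⟩,
      rfl⟩
    intro h
    exact hX.2.1.ne_singleton h.symm
  -- lifting continua through the internal composant
  have hlift : ∀ (L : Set ℂ) (z : ℂ), IsContinuum L → z ∈ Composant X x → f z ∈ L →
      ¬ connectedComponentIn (f ⁻¹' L) z ⊆ X → ∀ y ∈ X, (L ∩ Composant X y).Nonempty := by
    intro L z hL hz hzL hn y hy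
    rw [← hfX] at hy
    obtain ⟨w, hw, rfl⟩ := hy
    obtain ⟨a, haC, haX⟩ := not_subset.1 hn
    obtain ⟨b, hb, hbw⟩ := hint (connectedComponentIn (f ⁻¹' L) z)
      (aux_component (hperfect L hL.1) hzL) ⟨a, haC, haX⟩
      ⟨z, mem_connectedComponentIn (show z ∈ f ⁻¹' L from hzL), hz⟩ _ ⟨w, hw, rfl⟩
    exact ⟨f b, connectedComponentIn_subset (f ⁻¹' L) z hb, himg w (mem_image_of_mem f hbw)⟩
  refine ⟨⟨f x, hmaps x hx, (himg x).antisymm ?_⟩, ?_⟩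
  · rintro q ⟨Q, ⟨hQ, hQX, hQne, hxQ⟩, hqQ⟩
    have hCQ : f '' connectedComponentIn (f ⁻¹' Q) x = Q := hconf Q _ hQ ⟨x, hxQ, rfl⟩
    by_cases hC : connectedComponentIn (f ⁻¹' Q) x ⊆ X
    · rw [← hCQ] at hqQ
      obtain ⟨b, hb, rfl⟩ := hqQ
      refine mem_image_of_mem f ⟨_, ⟨aux_component (hperfect Q hQ.1) hxQ, hC, ?_,
        mem_connectedComponentIn (show x ∈ f ⁻¹' Q from hxQ)⟩, hb⟩
      intro h
      rw [h, hfX] at hCQ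
      exact hQne hCQ.symm
    · exfalso
      apply aux_baire hX (f x) (hmaps x hx)
      intro y hy
      obtain ⟨a, haQ, P, ⟨hP, hPX, hPne, hyP⟩, haP⟩ := hlift Q x hQ (hself x hx) hxQ hC y hy
      refine ⟨Q ∪ P, ⟨⟨hQ.1.union hP.1, hQ.2.union ⟨a, haQ, haP⟩ hP.2⟩, union_subset hQX hPX, ?_,
        Or.inl hxQ⟩, Or.inr hyP⟩
      intro h
      exact hX.2.2 ⟨Q, P, hQ, hP, hQX, hPX, hQne, hPne, h⟩
  · rintro L hL ⟨p, hpL, hpX⟩ ⟨_, hzL, z, hz, rfl⟩ _ ⟨y, hy, rfl⟩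
    refine hlift L z hL hz hzL ?_ y hy
    intro hC
    have hCL : f '' connectedComponentIn (f ⁻¹' L) z = L := hconf L _ hL ⟨z, hzL, rfl⟩
    rw [← hCL] at hpL
    obtain ⟨b, hb, rfl⟩ := hpL
    exact hpX (hmaps b (hC hb))
end

section
/- Let (f, τ, c) be degree −2 branched covering data with f confluent, and let X ⊆ ℂ be an indecomposable unshielded continuum with f(X) = X such that X ∩ τ(X) ≠ ∅ and τ(X) is not contained in X (equivalently, X is not fully invariant). Then X ∩ τ(X) is contained in E*_X, the union of all external composants of X; in particular, X ∩ τ(X) is a nonempty proper closed subset of X with empty interior in the subspace topology of X. -/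
open Set Topology Bornology

/-- The topological hull `T(Y)`: the complement of the unbounded connected
component of `ℂ \ Y`. -/
def hullC (Y : Set ℂ) : Set ℂ := {z | IsBounded (connectedComponentIn Yᶜ z)}

/-- `X` is unshielded: it equals the boundary of the unbounded component
of its complement. -/
def Unshielded (X : Set ℂ) : Prop := X = frontier (hullC X)ᶜ

/-- The union `E*_X` of all external (non-internal) composants of `X`. -/
def ExternalUnion (X : Set ℂ) : Set ℂ :=
  {y | ∃ Z : Set ℂ, IsComposant X Z ∧ ¬ IsInternalComposant X Z ∧ y ∈ Z}

/-- `φ` has a continuous logarithm on `A`. -/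
def HasLogOn (φ : ℂ → ℂ) (A : Set ℂ) : Prop :=
  ∃ l : ℂ → ℂ, ContinuousOn l A ∧ ∀ z ∈ A, Complex.exp (l z) = φ z

lemma hasLogOn_ball {φ : ℂ → ℂ} {c : ℂ} {r : ℝ} (hr : 0 < r)
    (hc : ContinuousOn φ (Metric.ball c r)) (h0 : ∀ z ∈ Metric.ball c r, φ z ≠ 0) :
    HasLogOn φ (Metric.ball c r) := by
  have hs : IsSimplyConnected (Metric.ball c r) := by
    have := Metric.contractibleSpace_ball (x := c) hr
    exact (inferInstance : SimplyConnectedSpace (Metric.ball c r))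
  obtain ⟨f, hf, he⟩ := Complex.exists_continuousOn_eqOn_exp_comp hs Metric.isOpen_ball hc
    (by rintro ⟨z, hz, h⟩; exact h0 z hz h)
  exact ⟨f, hf, fun z hz => he hz⟩

lemma HasLogOn.mono {φ : ℂ → ℂ} {A B : Set ℂ} (h : HasLogOn φ A) (hB : B ⊆ A) :
    HasLogOn φ B := by
  obtain ⟨l, hl, he⟩ := h
  exact ⟨l, hl.mono hB, fun z hz => he z (hB hz)⟩

lemma HasLogOn.mul {φ ψ χ : ℂ → ℂ} {A : Set ℂ} (h : HasLogOn φ A) (h' : HasLogOn ψ A)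
    (e : ∀ z ∈ A, χ z = φ z * ψ z) : HasLogOn χ A := by
  obtain ⟨l, hl, he⟩ := h
  obtain ⟨m, hm, hme⟩ := h'
  refine ⟨fun z => l z + m z, hl.add hm, fun z hz => ?_⟩
  rw [Complex.exp_add, he z hz, hme z hz, e z hz]

lemma HasLogOn.conj {φ : ℂ → ℂ} {A : Set ℂ} (h : HasLogOn φ A) :
    HasLogOn (fun z => (starRingEnd ℂ) (φ z)) A := by
  obtain ⟨l, hl, he⟩ := h
  refine ⟨fun z => (starRingEnd ℂ) (l z), Complex.continuous_conj.comp_continuousOn hl,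
    fun z hz => ?_⟩
  rw [Complex.exp_conj, he z hz]

lemma hasLogOn_of_slit {φ : ℂ → ℂ} {A : Set ℂ} (hc : ContinuousOn φ A)
    (h : ∀ z ∈ A, ‖φ z - 1‖ < 1) : HasLogOn φ A := by
  have hs : ∀ z ∈ A, φ z ∈ Complex.slitPlane := fun z hz => by
    have := Complex.mem_slitPlane_of_norm_lt_one (h z hz)
    simpa using this
  exact ⟨fun z => Complex.log (φ z), hc.clog hs,
    fun z hz => Complex.exp_log (Complex.slitPlane_ne_zero (hs z hz))⟩

/-- Local structure of a zero `p` of `ψ`. -/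
def GoodZero (A : Set ℂ) (ψ : ℂ → ℂ) (p : ℂ) : Prop :=
  ∃ k : ℂ → ℂ, Continuous k ∧ (∀ z, k z = 0 → z = p) ∧ HasLogOn k A ∧ ∃ δ > 0,
    ∃ l : ℂ → ℂ, ContinuousOn l (Metric.ball p δ \ {p}) ∧
      ∀ z ∈ Metric.ball p δ \ {p}, ψ z = k z * Complex.exp (l z)

lemma hasLogOn_of_finset {A : Set ℂ} (hA : IsClosed A) {r : ℝ} (hr : 0 < r)
    (hAr : A ⊆ Metric.ball 0 r) (n : ℕ) : ∀ (Zs : Finset ℂ) (ψ : ℂ → ℂ), Zs.card = n →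
    ContinuousOn ψ (Metric.ball 0 r) → (∀ z ∈ Metric.ball 0 r, ψ z = 0 → z ∈ Zs) →
    (∀ p ∈ Zs, p ∉ A ∧ GoodZero A ψ p) → HasLogOn ψ A := by
  classical
  induction n with
  | zero =>
    intro Zs ψ hn hc h0 _
    have : Zs = ∅ := Finset.card_eq_zero.1 hn
    subst this
    exact (hasLogOn_ball hr hc (fun z hz h => by simpa using h0 z hz h)).mono hAr
  | succ n ih =>
    intro Zs ψ hn hc h0 hg
    obtain ⟨p, hp⟩ : Zs.Nonempty := by
      rw [← Finset.card_pos]; omega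
    obtain ⟨hpA, k, hk, hk0, hkl, δ₀, hδ₀, l, hl, hle⟩ := hg p hp
    -- shrink the radius
    obtain ⟨δ, hδ, hδ', hδA, hδZ⟩ : ∃ δ > 0, δ ≤ δ₀ ∧ (∀ z ∈ A, δ < dist z p) ∧
        ∀ q ∈ Zs, q ≠ p → δ < dist q p := by
      have h1 : IsClosed (A ∪ ((Zs.erase p : Finset ℂ) : Set ℂ)) :=
        hA.union (Finset.finite_toSet _).isClosed
      have h2 : p ∉ A ∪ ((Zs.erase p : Finset ℂ) : Set ℂ) := by simp [hpA]
      obtain ⟨ε, hε, hb⟩ := Metric.isOpen_iff.1 h1.isOpen_compl p h2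
      have key : ∀ z ∈ A ∪ ((Zs.erase p : Finset ℂ) : Set ℂ), min δ₀ (ε/2) < dist z p := by
        intro z hz
        by_contra hlt
        exact hb (Metric.mem_ball.2 (lt_of_le_of_lt (not_lt.1 hlt)
          (lt_of_le_of_lt (min_le_right _ _) (by linarith)))) hz
      refine ⟨min δ₀ (ε/2), by positivity, min_le_left _ _, fun z hz => key z (Or.inl hz),
        fun q hq hqp => key q (Or.inr ?_)⟩
      simp [hq, hqp]
    set χ : ℂ → ℝ := fun z => min 1 (max 0 (6 * dist z p / δ - 2)) with hχ
    have hχc : Continuous χ := by fun_prop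
    have hχ0 : ∀ z, dist z p < δ / 3 → χ z = 0 := by
      intro z hz
      have : 6 * dist z p / δ - 2 ≤ 0 := by
        rw [sub_nonpos, div_le_iff₀ hδ]; linarith
      simp [hχ, max_eq_left this]
    have hχ1 : ∀ z, δ / 2 < dist z p → χ z = 1 := by
      intro z hz
      have : 1 ≤ 6 * dist z p / δ - 2 := by
        rw [le_sub_iff_add_le, le_div_iff₀ hδ]; linarith
      simp [hχ, this]
    set ψ' : ℂ → ℂ := fun z => if dist z p < δ then Complex.exp (χ z * l z) else ψ z / k z
      with hψ'
    have hkne : ∀ z, δ / 2 < dist z p → k z ≠ 0 := by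
      intro z hz h
      have := hk0 z h
      subst this
      simp at hz; linarith
    have hout : ∀ z, δ / 2 < dist z p → ψ' z = ψ z / k z := by
      intro z hz
      simp only [hψ']
      split_ifs with h
      · have hzp : z ∈ Metric.ball p δ₀ \ {p} := by
          refine ⟨Metric.mem_ball.2 (lt_of_lt_of_le h hδ'), ?_⟩
          rintro rfl
          simp at hz; linarith
        rw [hχ1 z hz, hle z hzp]
        field_simp [hkne z hz]
        simp
      · rfl
    have hne : ∀ z ∈ Metric.ball (0:ℂ) r, ψ' z = 0 → z ∈ Zs.erase p := by
      intro z hz h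
      by_cases hd : dist z p < δ
      · simp [hψ', hd] at h
      · have h2 : δ / 2 < dist z p := by linarith
        rw [hout z h2, div_eq_zero_iff] at h
        rcases h with h | h
        · rw [Finset.mem_erase]
          refine ⟨?_, h0 z hz h⟩
          rintro rfl
          simp at h2; linarith
        · exact absurd h (hkne z h2)
    have hcont : ContinuousOn ψ' (Metric.ball 0 r) := by
      intro z hz
      have hzn : Metric.ball (0:ℂ) r ∈ 𝓝 z := Metric.isOpen_ball.mem_nhds hz
      have hdist : Continuous fun w : ℂ => dist w p := by fun_prop
      apply ContinuousAt.continuousWithinAt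
      by_cases h1 : dist z p < δ / 3
      · have : ψ' =ᶠ[𝓝 z] fun _ => 1 := by
          filter_upwards [hdist.continuousAt.eventually (gt_mem_nhds h1)] with w hw
          have : dist w p < δ := by linarith
          simp [hψ', this, hχ0 w hw]
        exact continuousAt_const.congr this.symm
      by_cases h2 : dist z p < δ
      · have hzp : z ≠ p := by
          rintro rfl; simp at h1; linarith
        have hopen : IsOpen (Metric.ball p δ₀ \ {p}) :=
          Metric.isOpen_ball.sdiff isClosed_singleton
        have hlz : ContinuousAt l z := hl.continuousAt (hopen.mem_nhds
          ⟨Metric.mem_ball.2 (lt_of_lt_of_le h2 hδ'), hzp⟩)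
        have : ψ' =ᶠ[𝓝 z] fun w => Complex.exp (χ w * l w) := by
          filter_upwards [hdist.continuousAt.eventually (gt_mem_nhds h2)] with w hw
          simp [hψ', hw]
        refine ContinuousAt.congr ?_ this.symm
        have : ContinuousAt (fun w => (χ w : ℂ)) z :=
          (Complex.continuous_ofReal.comp hχc).continuousAt
        exact (this.mul hlz).cexp
      · have h3 : δ / 2 < dist z p := by linarith
        have : ψ' =ᶠ[𝓝 z] fun w => ψ w / k w := by
          filter_upwards [hdist.continuousAt.eventually (lt_mem_nhds h3)] with w hw
          exact hout w hw
        refine ContinuousAt.congr ?_ this.symm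
        exact (hc.continuousAt hzn).div hk.continuousAt (hkne z h3)
    have hfin := ih (Zs.erase p) ψ' (by rw [Finset.card_erase_of_mem hp, hn]; rfl) hcont hne ?_
    · refine hfin.mul hkl fun z hz => ?_
      have h2 : δ / 2 < dist z p := by linarith [hδA z hz]
      rw [hout z h2, div_mul_cancel₀ _ (hkne z h2)]
    · intro q hq
      rw [Finset.mem_erase] at hq
      obtain ⟨hqA, k', hk', hk0', hkl', δ₁, hδ₁, l', hl', hle'⟩ := hg q hq.2
      refine ⟨hqA, k', hk', hk0', hkl', min δ₁ (dist q p - δ), ?_, ?_⟩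
      · have := hδZ q hq.2 hq.1
        simp only [gt_iff_lt, lt_min_iff]; constructor <;> linarith
      set ρ := min δ₁ (dist q p - δ) with hρ
      have hρ0 : 0 < ρ := by
        have := hδZ q hq.2 hq.1
        simp only [hρ, lt_min_iff]; constructor <;> linarith
      have hfar : ∀ z ∈ Metric.ball q ρ, δ / 2 < dist z p := by
        intro z hz
        have h1 : dist z q < dist q p - δ := lt_of_lt_of_le (Metric.mem_ball.1 hz) (min_le_right _ _)
        have h2 : dist q p ≤ dist z q + dist z p := by
          rw [dist_comm z q]; exact dist_triangle _ _ _
        linarith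
      obtain ⟨m, hm, hme⟩ := hasLogOn_ball (φ := k) hρ0 hk.continuousOn
        (fun z hz => hkne z (hfar z hz))
      have hsub : Metric.ball q ρ \ {q} ⊆ Metric.ball q δ₁ \ {q} :=
        sdiff_subset_sdiff_left (Metric.ball_subset_ball (min_le_left _ _))
      refine ⟨fun z => l' z - m z, (hl'.mono hsub).sub (hm.mono sdiff_subset), fun z hz => ?_⟩
      rw [hout z (hfar z hz.1), hle' z (hsub hz), Complex.exp_sub, hme z hz.1]
      ring

lemma hasLogOn_sub_of_compl {A : Set ℂ} (hA : IsCompact A) (hAc : IsPreconnected Aᶜ) {p : ℂ}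
    (hp : p ∉ A) : HasLogOn (fun z => z - p) A := by
  have hbig : ∃ q, q ∉ A ∧ HasLogOn (fun z => z - q) A := by
    obtain ⟨r, hr, hAr⟩ := hA.isBounded.subset_ball_lt 0 0
    refine ⟨(r : ℂ), fun h => by simpa [abs_of_pos hr] using hAr h, ?_⟩
    have hr0 : (r : ℂ) ≠ 0 := by exact_mod_cast hr.ne'
    have h1 : HasLogOn (fun z => 1 - z / r) A := by
      refine hasLogOn_of_slit (by fun_prop) fun z hz => ?_
      have : ‖z‖ < r := by simpa using hAr hz
      simp only [sub_sub_cancel_left, norm_neg, norm_div, Complex.norm_real, Real.norm_eq_abs,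
        abs_of_pos hr]
      rwa [div_lt_one hr]
    have h2 : HasLogOn (fun _ => (-r : ℂ)) A :=
      ⟨fun _ => Complex.log (-r), continuousOn_const, fun z hz => Complex.exp_log (by simpa using hr0)⟩
    refine h1.mul h2 fun z hz => ?_
    field_simp
    ring
  obtain ⟨q, hq, hlq⟩ := hbig
  have := hAc.induction₂ (fun x y => HasLogOn (fun z => z - x) A ↔ HasLogOn (fun z => z - y) A)
    ?_ ?_ ?_ hq hp
  · exact this.1 hlq
  · intro x hx
    obtain ⟨ε, hε, hb⟩ := Metric.isOpen_iff.1 hA.isClosed.isOpen_compl x hx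
    have hdist : ∀ z ∈ A, ε ≤ ‖z - x‖ := by
      intro z hz
      by_contra h
      exact hb (by simpa [dist_eq_norm] using h) hz
    filter_upwards [mem_nhdsWithin_of_mem_nhds (Metric.ball_mem_nhds x (half_pos hε))] with y hy
    have hy' : ‖y - x‖ < ε / 2 := by simpa [dist_eq_norm] using hy
    have hdist' : ∀ z ∈ A, ε / 2 < ‖z - y‖ := by
      intro z hz
      have h1 := hdist z hz
      have h2 : ‖z - x‖ ≤ ‖z - y‖ + ‖y - x‖ := by
        simpa using norm_add_le (z - y) (y - x)
      linarith
    have gen : ∀ a b : ℂ, ‖a - b‖ < ε / 2 → (∀ z ∈ A, ε / 2 < ‖z - a‖) →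
        HasLogOn (fun z => z - a) A → HasLogOn (fun z => z - b) A := by
      intro a b hab ha h
      have hne : ∀ z ∈ A, z - a ≠ 0 := fun z hz h0 => by
        have := ha z hz
        rw [h0] at this; simp at this; linarith
      have h1 : HasLogOn (fun z => (z - b) / (z - a)) A := by
        refine hasLogOn_of_slit ?_ fun z hz => ?_
        · exact ContinuousOn.div (by fun_prop) (by fun_prop) hne
        · have : (z - b) / (z - a) - 1 = (a - b) / (z - a) := by
            field_simp [hne z hz]; ring
          rw [this, norm_div, div_lt_one (by linarith [ha z hz])]
          linarith [ha z hz]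
      exact h.mul h1 fun z hz => by field_simp [hne z hz]
    exact ⟨gen x y (by rwa [norm_sub_rev]) fun z hz => by linarith [hdist z hz],
      gen y x hy' hdist'⟩
  · intro x y z _ _ _ h1 h2
    exact h1.trans h2
  · intro x y _ _ h
    exact h.symm

lemma goodZero_of_fderiv {A : Set ℂ} (hA : IsCompact A) (hAc : IsPreconnected Aᶜ) {p : ℂ}
    (hp : p ∉ A) {ψ : ℂ → ℂ} (hψ : Continuous ψ) (h0 : ψ p = 0) {L : ℂ →L[ℝ] ℂ}
    (hL : HasFDerivAt ψ L p) (hdet : L.det ≠ 0) : GoodZero A ψ p := by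
  have hinj : ∀ w, L w = 0 → w = 0 := by
    intro w hw
    have hu : IsUnit (L : ℂ →ₗ[ℝ] ℂ) := (LinearMap.isUnit_iff_isUnit_det _).2 (isUnit_iff_ne_zero.2 hdet)
    have := (LinearMap.isUnit_iff_ker_eq_bot _).1 hu
    exact (LinearMap.ker_eq_bot'.1 this) w hw
  set a : ℂ := (L 1 - Complex.I * L Complex.I) / 2 with ha
  set b : ℂ := (L 1 + Complex.I * L Complex.I) / 2 with hb
  have hLw : ∀ w, L w = a * w + b * (starRingEnd ℂ) w := by
    intro w
    have h1 : w = w.re • (1:ℂ) + w.im • Complex.I := by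
      simp [Complex.re_add_im]
    conv_lhs => rw [h1]
    rw [map_add, map_smul, map_smul]
    have h2 : (starRingEnd ℂ) w = w.re - w.im * Complex.I := by
      apply Complex.ext <;> simp
    have h3 : w = w.re + w.im * Complex.I := (Complex.re_add_im w).symm
    rw [h2]
    conv_rhs => rw [h3]
    simp only [Complex.add_re, Complex.ofReal_re, Complex.mul_re, Complex.I_re, Complex.ofReal_im, Complex.I_im, Complex.add_im, Complex.mul_im, Complex.real_smul]
    rw [ha, hb]
    push_cast
    linear_combination ((w.im:ℂ) * L Complex.I) * Complex.I_sq
  have hab : ‖a‖ ≠ ‖b‖ := by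
    intro h
    by_cases ha0 : a = 0
    · have hb0 : b = 0 := by rw [ha0] at h; simpa using h.symm
      have := hinj 1 (by rw [hLw, ha0, hb0]; simp)
      exact one_ne_zero this
    · set u := -b / a with hu
      have hun : ‖u‖ = 1 := by
        rw [hu, norm_div, norm_neg, ← h, div_self (by simpa using ha0)]
      have huu : u * (starRingEnd ℂ) u = 1 := by
        rw [Complex.mul_conj, Complex.normSq_eq_norm_sq, hun]; simp
      have hbu : b = - a * u := by rw [hu]; field_simp
      by_cases hu1 : u = -1
      · have := hinj Complex.I (by rw [hLw, hbu, hu1]; simp)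
        exact Complex.I_ne_zero this
      · have := hinj (1 + u) (by
          rw [hLw, hbu, map_add, map_one]; linear_combination (-a) * huu)
        exact hu1 (by linear_combination this)
  -- the general step
  have gen : ∀ (k : ℂ → ℂ) (a b : ℂ) (k₂ : ℂ → ℂ), Continuous k → (∀ z, k z = 0 → z = p) →
      HasLogOn k A → ‖b‖ < ‖a‖ → (∀ z, ‖k z‖ = ‖z - p‖) → (∀ z, ‖k₂ z‖ = ‖z - p‖) →
      (∀ z, L (z - p) = a * k z + b * k₂ z) → GoodZero A ψ p := by
    intro k a b k₂ hk hk0 hkl hab hkn hk2n hLk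
    refine ⟨k, hk, hk0, hkl, ?_⟩
    have ha0 : a ≠ 0 := by
      rintro rfl
      simp at hab
      linarith [norm_nonneg b]
    have hapos : 0 < ‖a‖ := norm_pos_iff.2 ha0
    have hlit := (hasFDerivAt_iff_isLittleO.1 hL).def (c := (‖a‖ - ‖b‖) / 2) (by linarith)
    obtain ⟨δ, hδ, hball⟩ := Metric.eventually_nhds_iff_ball.1 hlit
    refine ⟨δ, hδ, ?_⟩
    have hkne : ∀ z ∈ Metric.ball p δ \ {p}, k z ≠ 0 := fun z hz h => hz.2 (hk0 z h)
    have h1 : HasLogOn (fun z => ψ z / (a * k z)) (Metric.ball p δ \ {p}) := by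
      refine hasLogOn_of_slit (hψ.continuousOn.div (by fun_prop) fun z hz =>
        mul_ne_zero ha0 (hkne z hz)) fun z hz => ?_
      have hak : a * k z ≠ 0 := mul_ne_zero ha0 (hkne z hz)
      have e : ψ z / (a * k z) - 1 = (ψ z - a * k z) / (a * k z) := by
        rw [sub_div, div_self hak]
      have hzp : 0 < ‖z - p‖ := by
        rw [norm_pos_iff, sub_ne_zero]; exact hz.2
      rw [e, norm_div, div_lt_one (norm_pos_iff.2 hak), norm_mul, hkn]
      have h2 := hball z hz.1
      rw [h0, sub_zero, hLk] at h2
      have h3 : ψ z - a * k z = (ψ z - (a * k z + b * k₂ z)) + b * k₂ z := by ring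
      have h4 : ‖ψ z - a * k z‖ ≤ (‖a‖ - ‖b‖) / 2 * ‖z - p‖ + ‖b‖ * ‖z - p‖ := by
        rw [h3]
        refine (norm_add_le _ _).trans (add_le_add h2 ?_)
        rw [norm_mul, hk2n]
      nlinarith
    obtain ⟨l, hl, hle⟩ := h1
    refine ⟨fun z => l z + Complex.log a, hl.add continuousOn_const, fun z hz => ?_⟩
    rw [Complex.exp_add, hle z hz, Complex.exp_log ha0]
    field_simp [hkne z hz]
  have hlog := hasLogOn_sub_of_compl hA hAc hp
  rcases lt_or_gt_of_ne hab with h | h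
  · refine gen (fun z => (starRingEnd ℂ) (z - p)) b a (fun z => z - p) (Complex.continuous_conj.comp (by fun_prop)) ?_ hlog.conj h ?_ ?_ ?_
    · intro z hz
      have : z - p = 0 := by simpa only [map_eq_zero] using hz
      exact sub_eq_zero.1 this
    · intro z; exact Complex.norm_conj _
    · intro z; rfl
    · intro z; rw [hLw]; ring
  · refine gen (fun z => z - p) a b (fun z => (starRingEnd ℂ) (z - p)) (by fun_prop) ?_ hlog h ?_ ?_ ?_
    · intro z hz
      exact sub_eq_zero.1 hz
    · intro z; rfl
    · intro z; exact Complex.norm_conj _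
    · intro z; rw [hLw]

/-- Borsuk: a nonvanishing map on a compact set that does not separate the plane has a
continuous logarithm. -/
lemma hasLogOn_of_compl {A : Set ℂ} (hA : IsCompact A) (hAc : IsPreconnected Aᶜ)
    {φ : ℂ → ℂ} (hφ : ContinuousOn φ A) (h0 : ∀ z ∈ A, φ z ≠ 0) : HasLogOn φ A := by
  rcases A.eq_empty_or_nonempty with rfl | hne
  · exact ⟨fun _ => 0, continuousOn_empty _, by simp⟩
  obtain ⟨F, hF⟩ := ContinuousMap.exists_restrict_eq hA.isClosed
    (⟨A.domRestrict φ, continuousOn_iff_continuous_domRestrict.mp hφ⟩ : C(A, ℂ))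
  have hFA : ∀ z ∈ A, F z = φ z := fun z hz => by
    have := congrArg (fun g : C(A, ℂ) => g ⟨z, hz⟩) hF
    simpa using this
  obtain ⟨m, hm, hmA⟩ : ∃ m > 0, ∀ z ∈ A, m ≤ ‖F z‖ := by
    obtain ⟨z₀, hz₀, hmin⟩ := hA.exists_isMinOn hne (f := fun z => ‖F z‖) (by fun_prop)
    exact ⟨‖F z₀‖, norm_pos_iff.2 (by rw [hFA z₀ hz₀]; exact h0 z₀ hz₀), fun z hz => hmin hz⟩
  obtain ⟨g, hg, hgF, -⟩ := F.continuous.exists_contDiff_approx (ε := fun _ => m / 2) 1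
    continuous_const (fun _ => by linarith)
  have hgd : Differentiable ℝ g := hg.differentiable (by simp)
  -- regular value
  obtain ⟨ε, hε, hεreg⟩ : ∃ ε : ℂ, ‖ε‖ < m / 2 ∧ ∀ z, g z = ε → (fderiv ℝ g z).det ≠ 0 := by
    have hmeas := MeasureTheory.addHaar_image_eq_zero_of_det_fderivWithin_eq_zero
      (MeasureTheory.volume : MeasureTheory.Measure ℂ) (f := g) (f' := fderiv ℝ g)
      (s := {z | (fderiv ℝ g z).det = 0})
      (fun x _ => (hgd x).hasFDerivAt.hasFDerivWithinAt) (fun x hx => hx)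
    by_contra hcon
    push Not at hcon
    have hsub : Metric.ball (0:ℂ) (m/2) ⊆ g '' {z | (fderiv ℝ g z).det = 0} := by
      intro ε hε
      obtain ⟨z, hz, hd⟩ := hcon ε (by simpa using hε)
      exact ⟨z, hd, hz⟩
    have hpos := Metric.measure_ball_pos (MeasureTheory.volume : MeasureTheory.Measure ℂ) (0:ℂ)
      (half_pos hm)
    exact hpos.ne' (MeasureTheory.measure_mono_null hsub hmeas)
  set ψ : ℂ → ℂ := fun z => g z - ε with hψdef
  have hψc : Continuous ψ := hg.continuous.sub continuous_const
  have hψd : ∀ z, HasFDerivAt ψ (fderiv ℝ g z) z := fun z =>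
    (hgd z).hasFDerivAt.sub_const ε
  have hclose : ∀ z ∈ A, ‖ψ z - F z‖ < ‖F z‖ := by
    intro z hz
    have h1 : ‖g z - F z‖ < m / 2 := by simpa [dist_eq_norm] using hgF z
    have h2 : ψ z - F z = (g z - F z) - ε := by simp [hψdef]; ring
    rw [h2]
    linarith [norm_sub_le (g z - F z) ε, hmA z hz]
  have hFne : ∀ z ∈ A, F z ≠ 0 := fun z hz h => by
    have := hmA z hz
    rw [h] at this; simp at this; linarith
  have hψne : ∀ z ∈ A, ψ z ≠ 0 := fun z hz h => by
    have := hclose z hz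
    rw [h] at this; simp at this
  obtain ⟨r, hr, hAr⟩ := hA.isBounded.subset_ball_lt 0 0
  have hgood : ∀ p, ψ p = 0 → p ∉ A ∧ GoodZero A ψ p := by
    intro p hp
    have hpA : p ∉ A := fun h => hψne p h hp
    exact ⟨hpA, goodZero_of_fderiv hA hAc hpA hψc hp (hψd p)
      (hεreg p (by simpa [hψdef, sub_eq_zero] using hp))⟩
  have hfin : ({z | ψ z = 0} ∩ Metric.closedBall 0 r).Finite := by
    by_contra hinf
    obtain ⟨p, hpK, hacc⟩ := Set.Infinite.exists_accPt_of_subset_isCompact hinf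
      (isCompact_closedBall (0:ℂ) r) inter_subset_right
    have hp0 : ψ p = 0 := by
      have hcl : IsClosed {z | ψ z = 0} := isClosed_eq hψc continuous_const
      have : p ∈ closure {z | ψ z = 0} :=
        mem_closure_iff_clusterPt.2 (hacc.clusterPt.mono (Filter.principal_mono.2 inter_subset_left))
      rwa [hcl.closure_eq] at this
    obtain ⟨-, k, -, hk0, -, δ, hδ, l, -, hle⟩ := hgood p hp0
    rw [accPt_iff_nhds] at hacc
    obtain ⟨y, ⟨hy1, hy2⟩, hyp⟩ := hacc _ (Metric.ball_mem_nhds p hδ)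
    have h1 := hle y ⟨hy1, hyp⟩
    have h2 : ψ y = 0 := hy2.1
    rw [h2] at h1
    rcases mul_eq_zero.1 h1.symm with h | h
    · exact hyp (hk0 y h)
    · exact Complex.exp_ne_zero _ h
  have hlogψ : HasLogOn ψ A := hasLogOn_of_finset hA.isClosed hr hAr _ hfin.toFinset ψ rfl
    hψc.continuousOn (fun z hz h => by
      simp only [Set.Finite.mem_toFinset]
      exact ⟨h, Metric.ball_subset_closedBall hz⟩)
    (fun p hp => hgood p (by
      simp only [Set.Finite.mem_toFinset] at hp
      exact hp.1))
  have hquot : HasLogOn (fun z => ψ z / F z) A := by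
    refine hasLogOn_of_slit (hψc.continuousOn.div (by fun_prop) hFne) fun z hz => ?_
    have : ψ z / F z - 1 = (ψ z - F z) / F z := by field_simp [hFne z hz]
    rw [this, norm_div, div_lt_one (norm_pos_iff.2 (hFne z hz))]
    exact hclose z hz
  obtain ⟨l₁, hl₁, he₁⟩ := hlogψ
  obtain ⟨l₂, hl₂, he₂⟩ := hquot
  refine ⟨fun z => l₁ z - l₂ z, hl₁.sub hl₂, fun z hz => ?_⟩
  rw [Complex.exp_sub, he₁ z hz, he₂ z hz, ← hFA z hz]
  field_simp [hFne z hz, hψne z hz]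

lemma eq_of_exp_eq_one {S : Set ℂ} (hS : IsPreconnected S) {g : ℂ → ℂ} (hg : ContinuousOn g S)
    (h1 : ∀ z ∈ S, Complex.exp (g z) = 1) {a b : ℂ} (ha : a ∈ S) (hb : b ∈ S) : g a = g b := by
  have h2 : ∀ z, ∃ n : ℤ, z ∈ S → g z = n * (2 * Real.pi * Complex.I) := by
    intro z
    by_cases hz : z ∈ S
    · obtain ⟨n, hn⟩ := Complex.exp_eq_one_iff.1 (h1 z hz)
      exact ⟨n, fun _ => hn⟩
    · exact ⟨0, fun h => (hz h).elim⟩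
  choose n hn using h2
  have hc : ContinuousOn n S := by
    rw [Int.isClosedEmbedding_coe_real.isInducing.continuousOn_iff]
    have : ContinuousOn (fun z => (g z).im / (2 * Real.pi)) S :=
      (Complex.continuous_im.comp_continuousOn hg).div_const _
    refine this.congr fun z hz => ?_
    show (n z : ℝ) = (g z).im / (2 * Real.pi)
    rw [hn z hz]
    have := Real.pi_ne_zero
    simp
  rw [hn a ha, hn b hb, hS.constant hc ha hb]

lemma janiszewski_inter {K R : Set ℂ} (hK : IsCompact K) (hR : IsCompact R)
    (hKp : IsPreconnected K) (hRp : IsPreconnected R) (hc : IsPreconnected (K ∪ R)ᶜ) :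
    IsPreconnected (K ∩ R) := by
  rw [isPreconnected_closed_iff]
  intro t t' ht ht' hsub ⟨a, haKR, hat⟩ ⟨b, hbKR, hbt⟩
  by_contra hne
  have hKR : IsClosed (K ∩ R) := hK.isClosed.inter hR.isClosed
  obtain ⟨u, hu0, hu1, -⟩ := exists_continuous_zero_one_of_isClosed
    (hKR.inter ht) (hKR.inter ht') (by
      rw [Set.disjoint_left]
      rintro z ⟨h1, h2⟩ ⟨_, h3⟩
      exact hne ⟨z, h1, h2, h3⟩)
  have hu : Continuous fun z => (u z : ℂ) := Complex.continuous_ofReal.comp u.continuous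
  classical
  set φ : ℂ → ℂ := fun z => if z ∈ K then Complex.exp (Real.pi * u z * Complex.I)
    else Complex.exp (-(Real.pi * u z * Complex.I)) with hφ
  have hφK : ∀ z ∈ K, φ z = Complex.exp (Real.pi * u z * Complex.I) := fun z hz => by
    simp [hφ, hz]
  have hφR : ∀ z ∈ R, φ z = Complex.exp (-(Real.pi * u z * Complex.I)) := fun z hz => by
    by_cases hzK : z ∈ K
    · rw [hφK z hzK]
      rcases hsub ⟨hzK, hz⟩ with h | h
      · have : u z = 0 := hu0 ⟨⟨hzK, hz⟩, h⟩
        simp [this]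
      · have : u z = 1 := hu1 ⟨⟨hzK, hz⟩, h⟩
        rw [this, Complex.exp_neg]
        simp [Complex.exp_pi_mul_I]
    · simp [hφ, hzK]
  have hφc : ContinuousOn φ (K ∪ R) := by
    refine ContinuousOn.union_of_isClosed ?_ ?_ hK.isClosed hR.isClosed
    · exact (Continuous.continuousOn (by fun_prop)).congr hφK
    · exact (Continuous.continuousOn (by fun_prop)).congr hφR
  obtain ⟨l, hl, hle⟩ := hasLogOn_of_compl (hK.union hR) hc hφc (by
    rintro z (hz | hz)
    · rw [hφK z hz]; exact Complex.exp_ne_zero _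
    · rw [hφR z hz]; exact Complex.exp_ne_zero _)
  have e1 := eq_of_exp_eq_one hKp (g := fun z => l z - Real.pi * u z * Complex.I)
    ((hl.mono subset_union_left).sub (Continuous.continuousOn (by fun_prop))) (by
      intro z hz
      rw [Complex.exp_sub, hle z (Or.inl hz), hφK z hz, div_self (Complex.exp_ne_zero _)])
      haKR.1 hbKR.1
  have e2 := eq_of_exp_eq_one hRp (g := fun z => l z - -(Real.pi * u z * Complex.I))
    ((hl.mono subset_union_right).sub (Continuous.continuousOn (by fun_prop))) (by
      intro z hz
      rw [Complex.exp_sub, hle z (Or.inr hz), hφR z hz, div_self (Complex.exp_ne_zero _)])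
      haKR.2 hbKR.2
  have ua : u a = 0 := hu0 ⟨haKR, hat⟩
  have ub : u b = 1 := hu1 ⟨hbKR, hbt⟩
  simp only [ua, ub] at e1 e2
  have : (Real.pi : ℂ) * Complex.I = 0 := by
    push_cast at e1 e2
    linear_combination (e1 - e2) / 2
  have h3 := mul_ne_zero (Complex.ofReal_ne_zero.2 Real.pi_ne_zero) Complex.I_ne_zero
  exact h3 this

lemma frontier_comp_subset {T : Set ℂ} (hT : IsClosed T) (x : ℂ) :
    frontier (connectedComponentIn Tᶜ x) ⊆ T := by
  intro y hy
  by_contra hyT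
  have ho : IsOpen (connectedComponentIn Tᶜ y) := hT.isOpen_compl.connectedComponentIn
  have hox : IsOpen (connectedComponentIn Tᶜ x) := hT.isOpen_compl.connectedComponentIn
  have hyy : y ∈ connectedComponentIn Tᶜ y := mem_connectedComponentIn hyT
  obtain ⟨w, hw1, hw2⟩ := mem_closure_iff.1 (frontier_subset_closure hy) _ ho hyy
  have e : connectedComponentIn Tᶜ y = connectedComponentIn Tᶜ x :=
    (connectedComponentIn_eq hw1).trans (connectedComponentIn_eq hw2).symm
  rw [e] at hyy
  have := hox.inter_frontier_eq
  exact (this ▸ ⟨hyy, hy⟩ : y ∈ (∅ : Set ℂ))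

lemma subset_of_frontier {S D : Set ℂ} (hS : IsPreconnected S) (hD : IsOpen D)
    (hf : ∀ z ∈ S, z ∉ frontier D) (hne : (S ∩ D).Nonempty) : S ⊆ D := by
  refine hS.subset_left_of_subset_union hD isClosed_closure.isOpen_compl (v := (closure D)ᶜ) ?_ ?_ hne
  · exact disjoint_compl_right.mono_left subset_closure |>.symm.symm
  · intro z hz
    by_cases h : z ∈ closure D
    · left
      by_contra hzD
      exact hf z hz ⟨h, by rwa [hD.interior_eq]⟩
    · exact Or.inr h

lemma compl_comp_preconnected {Y : Set ℂ} (hY : IsClosed Y) (hYc : IsConnected Y) {o : ℂ} :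
    IsPreconnected (connectedComponentIn Yᶜ o)ᶜ := by
  obtain ⟨⟨y0, hy0⟩, hYp⟩ := hYc
  have hYH : Y ⊆ (connectedComponentIn Yᶜ o)ᶜ := fun z hz h =>
    connectedComponentIn_subset _ _ h hz
  refine isPreconnected_of_forall y0 fun z hz => ?_
  by_cases hzY : z ∈ Y
  · exact ⟨Y, hYH, hy0, hzY, hYp⟩
  set C := connectedComponentIn Yᶜ z with hC
  have hzC : z ∈ C := mem_connectedComponentIn hzY
  have hCne : C ≠ univ := fun h => connectedComponentIn_subset _ _ (h ▸ mem_univ y0 : y0 ∈ C) hy0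
  obtain ⟨w, hw⟩ := nonempty_frontier_iff.2 ⟨⟨z, hzC⟩, hCne⟩
  refine ⟨Y ∪ closure C, union_subset hYH ?_, Or.inl hy0, Or.inr (subset_closure hzC), ?_⟩
  · have hox : IsOpen (connectedComponentIn Yᶜ o) := hY.isOpen_compl.connectedComponentIn
    refine closure_minimal ?_ hox.isClosed_compl
    intro v hv hv2
    apply hz
    rw [connectedComponentIn_eq hv2, ← connectedComponentIn_eq hv]
    exact hzC
  · exact hYp.union w (frontier_comp_subset hY z hw) (frontier_subset_closure hw)
      isPreconnected_connectedComponentIn.closure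

/-- The points cut off by `R`. -/
def cutOff (Y : Set ℂ) (o : ℂ) (R : Set ℂ) : Set ℂ :=
  {p | p ∈ connectedComponentIn Yᶜ o ∧ p ∉ R ∧ p ∉ connectedComponentIn (Y ∪ R)ᶜ o}

lemma cutOff_isOpen {Y : Set ℂ} {o : ℂ} {R : Set ℂ} (hY : IsClosed Y) (hR : IsClosed R) :
    IsOpen (cutOff Y o R) := by
  have e : cutOff Y o R = connectedComponentIn Yᶜ o ∩ Rᶜ ∩
      (closure (connectedComponentIn (Y ∪ R)ᶜ o))ᶜ := by
    have hYR : IsClosed (Y ∪ R) := hY.union hR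
    ext p
    constructor
    · rintro ⟨h1, h2, h3⟩
      refine ⟨⟨h1, h2⟩, fun h => ?_⟩
      have : p ∈ frontier (connectedComponentIn (Y ∪ R)ᶜ o) := by
        refine ⟨h, ?_⟩
        rwa [(IsOpen.connectedComponentIn hYR.isOpen_compl).interior_eq]
      rcases frontier_comp_subset hYR o this with h | h
      · exact connectedComponentIn_subset _ _ h1 h
      · exact h2 h
    · rintro ⟨⟨h1, h2⟩, h3⟩
      exact ⟨h1, h2, fun h => h3 (subset_closure h)⟩
  rw [e]
  exact ((hY.isOpen_compl.connectedComponentIn).inter hR.isOpen_compl).inter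
    isClosed_closure.isOpen_compl

lemma closure_access {T O : Set ℂ} (hT : IsClosed T) (hO : IsPreconnected O) {o : ℂ} (ho : o ∈ O)
    (hd : Disjoint O T) {z : ℂ} (hz : z ∈ closure O) (hzT : z ∉ T) :
    z ∈ connectedComponentIn Tᶜ o := by
  by_contra h
  have hsub : O ⊆ connectedComponentIn Tᶜ o :=
    hO.subset_connectedComponentIn ho (Set.disjoint_left.1 hd)
  apply hzT
  apply frontier_comp_subset hT o
  exact ⟨closure_mono hsub hz, by rwa [(IsOpen.connectedComponentIn hT.isOpen_compl).interior_eq]⟩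

lemma cutOff_nonempty {Y R O : Set ℂ} {o : ℂ} (hY : IsClosed Y) (hYc : IsConnected Y)
    (hR : IsCompact R) (hRp : IsPreconnected R) (hO : IsPreconnected O) (ho : o ∈ O)
    (hOb : IsBounded Oᶜ) (hOY : Disjoint O Y) (hRO : R ⊆ closure O)
    (hn : ¬ IsPreconnected (R ∩ Y)) : (cutOff Y o R).Nonempty := by
  by_contra hemp
  rw [Set.not_nonempty_iff_eq_empty, Set.eq_empty_iff_forall_notMem] at hemp
  set H := connectedComponentIn Yᶜ o with hH
  have hHo : IsOpen H := hY.isOpen_compl.connectedComponentIn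
  have hOH : O ⊆ H := hO.subset_connectedComponentIn ho (Set.disjoint_left.1 hOY)
  have hHc : IsCompact Hᶜ := Metric.isCompact_of_isClosed_isBounded hHo.isClosed_compl
    (hOb.subset (compl_subset_compl.2 hOH))
  have e : (Hᶜ ∪ R)ᶜ = connectedComponentIn (Y ∪ R)ᶜ o := by
    rw [compl_union, compl_compl]
    apply subset_antisymm
    · rintro z ⟨h1, h2⟩
      by_contra h3
      exact hemp z ⟨h1, h2, h3⟩
    · intro z hz
      exact ⟨connectedComponentIn_mono o (compl_subset_compl.2 subset_union_left) hz,
        fun h => connectedComponentIn_subset _ _ hz (Or.inr h)⟩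
  have hj := janiszewski_inter hHc hR (compl_comp_preconnected hY hYc) hRp
    (e ▸ isPreconnected_connectedComponentIn)
  apply hn
  convert hj using 1
  ext z
  constructor
  · rintro ⟨h1, h2⟩
    exact ⟨fun h => connectedComponentIn_subset _ _ h h2, h1⟩
  · rintro ⟨h1, h2⟩
    refine ⟨h2, ?_⟩
    by_contra h3
    exact h1 (closure_access hY hO ho hOY (hRO h2) h3)

lemma cutOff_disjoint {Y R₁ R₂ O : Set ℂ} {o : ℂ} (hY : IsClosed Y)
    (hR₁ : IsClosed R₁) (hR₂ : IsClosed R₂) (hO : IsPreconnected O) (ho : o ∈ O)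
    (hOY : Disjoint O Y) (hOR₁ : Disjoint O R₁) (hOR₂ : Disjoint O R₂)
    (hRO₁ : R₁ ⊆ closure O) (hRO₂ : R₂ ⊆ closure O) (hd : Disjoint R₁ R₂) :
    Disjoint (cutOff Y o R₁) (cutOff Y o R₂) := by
  have key : ∀ R₁ R₂ : Set ℂ, IsClosed R₁ → Disjoint O R₁ → R₂ ⊆ closure O → Disjoint R₁ R₂ →
      ∀ p ∈ cutOff Y o R₁,
      connectedComponentIn (Y ∪ R₁)ᶜ p ⊆ connectedComponentIn (Y ∪ R₂)ᶜ p := by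
    intro R₁ R₂ hR₁ hOR₁ hRO₂ hd p hp
    have hpT : p ∉ Y ∪ R₁ := fun h => h.elim (connectedComponentIn_subset _ _ hp.1) hp.2.1
    refine isPreconnected_connectedComponentIn.subset_connectedComponentIn
      (mem_connectedComponentIn hpT) fun z hz => ?_
    have hzT : z ∉ Y ∪ R₁ := connectedComponentIn_subset _ _ hz
    rintro (h | h)
    · exact hzT (Or.inl h)
    · have h4 := closure_access (hY.union hR₁) hO ho (hOY.union_right hOR₁) (hRO₂ h) hzT
      apply hp.2.2
      rw [connectedComponentIn_eq h4, ← connectedComponentIn_eq hz]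
      exact mem_connectedComponentIn hpT
  rw [Set.disjoint_left]
  intro p hp1 hp2
  have hpT : p ∉ Y ∪ R₁ := fun h => h.elim (connectedComponentIn_subset _ _ hp1.1) hp1.2.1
  have e : connectedComponentIn (Y ∪ R₁)ᶜ p = connectedComponentIn (Y ∪ R₂)ᶜ p :=
    subset_antisymm (key R₁ R₂ hR₁ hOR₁ hRO₂ hd p hp1) (key R₂ R₁ hR₂ hOR₂ hRO₁ hd.symm p hp2)
  have hfr : frontier (connectedComponentIn (Y ∪ R₁)ᶜ p) ⊆ Y := by
    intro z hz
    rcases frontier_comp_subset (hY.union hR₁) p hz with h | h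
    · exact h
    rw [e] at hz
    rcases frontier_comp_subset (hY.union hR₂) p hz with h2 | h2
    · exact h2
    · exact (Set.disjoint_left.1 hd h h2).elim
  have hoY : o ∉ Y := Set.disjoint_left.1 hOY ho
  have hsub := subset_of_frontier (S := connectedComponentIn Yᶜ o)
    isPreconnected_connectedComponentIn
    (IsOpen.connectedComponentIn (hY.union hR₁).isOpen_compl)
    (fun z hz h => connectedComponentIn_subset _ _ hz (hfr h))
    ⟨p, hp1.1, mem_connectedComponentIn hpT⟩
  have ho2 := hsub (mem_connectedComponentIn hoY)
  apply hp1.2.2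
  rw [← connectedComponentIn_eq ho2]
  exact mem_connectedComponentIn hpT

lemma isClosed_compIn {N : Set ℂ} (hN : IsClosed N) (x : ℂ) :
    IsClosed (connectedComponentIn N x) := by
  by_cases hx : x ∈ N
  · rw [← closure_eq_iff_isClosed]
    refine subset_antisymm ?_ subset_closure
    exact isPreconnected_connectedComponentIn.closure.subset_connectedComponentIn
      (subset_closure (mem_connectedComponentIn hx))
      (closure_minimal (connectedComponentIn_subset _ _) hN)
  · rw [connectedComponentIn_eq_empty hx]; exact isClosed_empty

/-- A proper subcontinuum of `X`. -/
def PropSub (X R : Set ℂ) : Prop := IsContinuum R ∧ R ⊆ X ∧ R ≠ X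

lemma piece_conn {X R U V : Set ℂ} (hX : IsClosed X) (hXp : IsPreconnected X) (hR : IsClosed R)
    (hRp : IsPreconnected R) (hRne : R.Nonempty) (hRX : R ⊆ X) (hU : IsOpen U) (hV : IsOpen V)
    (hcov : X \ R ⊆ U ∪ V) (hd : ∀ z ∈ X \ R, ¬ (z ∈ U ∧ z ∈ V)) :
    IsPreconnected (X ∩ (V ∩ Rᶜ)ᶜ) := by
  have hA : IsClosed (X ∩ (V ∩ Rᶜ)ᶜ) := hX.inter (hV.inter hR.isOpen_compl).isClosed_compl
  have hB : IsClosed (X ∩ (U ∩ Rᶜ)ᶜ) := hX.inter (hU.inter hR.isOpen_compl).isClosed_compl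
  have hRA : R ⊆ X ∩ (V ∩ Rᶜ)ᶜ := fun z hz => ⟨hRX hz, fun h => h.2 hz⟩
  have main : ∀ t t' : Set ℂ, IsClosed t → IsClosed t' → X ∩ (V ∩ Rᶜ)ᶜ ⊆ t ∪ t' →
      X ∩ (V ∩ Rᶜ)ᶜ ∩ (t ∩ t') = ∅ → R ⊆ t → X ∩ (V ∩ Rᶜ)ᶜ ⊆ t := by
    intro t t' ht ht' hc hdj hRt
    by_contra hns
    obtain ⟨w, hw, hwt⟩ := not_subset.1 hns
    have hwt' : w ∈ t' := (hc hw).resolve_left hwt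
    have hwR : w ∉ R := fun h => hwt (hRt h)
    have hX1 : X ⊆ (X ∩ (V ∩ Rᶜ)ᶜ ∩ t') ∪ ((X ∩ (V ∩ Rᶜ)ᶜ ∩ t) ∪ (X ∩ (U ∩ Rᶜ)ᶜ)) := by
      intro z hz
      by_cases hzV : z ∈ V ∩ Rᶜ
      · right; right
        exact ⟨hz, fun h => hd z ⟨hz, hzV.2⟩ ⟨h.1, hzV.1⟩⟩
      · rcases hc ⟨hz, hzV⟩ with h | h
        · exact Or.inr (Or.inl ⟨⟨hz, hzV⟩, h⟩)
        · exact Or.inl ⟨⟨hz, hzV⟩, h⟩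
    have hne2 : (X ∩ ((X ∩ (V ∩ Rᶜ)ᶜ ∩ t) ∪ (X ∩ (U ∩ Rᶜ)ᶜ))).Nonempty := by
      obtain ⟨r, hr⟩ := hRne
      exact ⟨r, hRX hr, Or.inl ⟨hRA hr, hRt hr⟩⟩
    have := isPreconnected_closed_iff.1 hXp _ _ (hA.inter ht') ((hA.inter ht).union hB) hX1
      ⟨w, hw.1, hw, hwt'⟩ hne2
    obtain ⟨z, hz, ⟨hzA, hzt'⟩, h | h⟩ := this
    · have : z ∈ (∅ : Set ℂ) := hdj ▸ ⟨hzA, h.2, hzt'⟩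
      exact this
    · by_cases hzR : z ∈ R
      · have : z ∈ (∅ : Set ℂ) := hdj ▸ ⟨hzA, hRt hzR, hzt'⟩
        exact this
      · rcases hcov ⟨hz, hzR⟩ with h1 | h1
        · exact h.2 ⟨h1, hzR⟩
        · exact hzA.2 ⟨h1, hzR⟩
  rw [isPreconnected_iff_subset_of_disjoint_closed]
  intro t t' ht ht' hc hdj
  rcases (isPreconnected_iff_subset_of_disjoint_closed.1 hRp) t t' ht ht' (hRA.trans hc)
    (subset_empty_iff.1 (hdj ▸ inter_subset_inter_left _ hRA)) with h | h
  · exact Or.inl (main t t' ht ht' hc hdj h)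
  · exact Or.inr (main t' t ht' ht (by rwa [union_comm]) (by rwa [inter_comm t']) h)

lemma indec_dense_compl {X R : Set ℂ} (hX : IndecomposableC X) (hR : PropSub X R) :
    X ⊆ closure (X \ R) := by
  obtain ⟨⟨hXc, hXn⟩, -, hind⟩ := hX
  obtain ⟨⟨hRc, hRn⟩, hRX, hRne⟩ := hR
  by_contra hns
  obtain ⟨x, hxX, hx⟩ := not_subset.1 hns
  have hS : (X \ R).Nonempty := by
    rw [Set.nonempty_iff_ne_empty]
    intro h
    exact hRne (subset_antisymm hRX (by rwa [Set.sdiff_eq_empty] at h))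
  have hSX : closure (X \ R) ⊆ X := closure_minimal sdiff_subset hXc.isClosed
  by_cases hp : IsPreconnected (X \ R)
  · apply hind
    refine ⟨R, closure (X \ R), ⟨hRc, hRn⟩, ⟨hXc.of_isClosed_subset isClosed_closure hSX,
      hS.closure, hp.closure⟩, hRX, hSX, hRne, fun h => hx (h.symm.subset hxX), ?_⟩
    refine subset_antisymm (union_subset hRX hSX) fun z hz => ?_
    by_cases h : z ∈ R
    · exact Or.inl h
    · exact Or.inr (subset_closure ⟨hz, h⟩)
  · rw [IsPreconnected] at hp
    push Not at hp
    obtain ⟨U, V, hU, hV, hcov, ⟨u, huS, huU⟩, ⟨v, hvS, hvV⟩, hUV⟩ := hp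
    have hd : ∀ z ∈ X \ R, ¬ (z ∈ U ∧ z ∈ V) := fun z hz h => by
      have : z ∈ (∅ : Set ℂ) := hUV ▸ ⟨hz, h⟩
      exact this
    apply hind
    have hRn' := hRn.nonempty
    obtain ⟨r, hr⟩ := hRn'
    refine ⟨X ∩ (V ∩ Rᶜ)ᶜ, X ∩ (U ∩ Rᶜ)ᶜ,
      ⟨hXc.inter_right (hV.inter hRc.isClosed.isOpen_compl).isClosed_compl, ⟨r, hRX hr, fun h => h.2 hr⟩,
        piece_conn hXc.isClosed hXn.2 hRc.isClosed hRn.2 hRn.1 hRX hU hV hcov hd⟩,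
      ⟨hXc.inter_right (hU.inter hRc.isClosed.isOpen_compl).isClosed_compl, ⟨r, hRX hr, fun h => h.2 hr⟩,
        piece_conn hXc.isClosed hXn.2 hRc.isClosed hRn.2 hRn.1 hRX hV hU (by rwa [union_comm])
          fun z hz h => hd z hz h.symm⟩, inter_subset_left, inter_subset_left, ?_, ?_, ?_⟩
    · intro h
      exact (h.symm ▸ hvS.1 : v ∈ X ∩ (V ∩ Rᶜ)ᶜ).2 ⟨hvV, hvS.2⟩
    · intro h
      exact (h.symm ▸ huS.1 : u ∈ X ∩ (U ∩ Rᶜ)ᶜ).2 ⟨huU, huS.2⟩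
    · refine subset_antisymm (union_subset inter_subset_left inter_subset_left) fun z hz => ?_
      by_cases h : z ∈ V ∩ Rᶜ
      · exact Or.inr ⟨hz, fun h2 => hd z ⟨hz, h.2⟩ ⟨h2.1, h.1⟩⟩
      · exact Or.inl ⟨hz, h⟩

lemma mem_composant_iff {X : Set ℂ} {x y : ℂ} :
    y ∈ Composant X x ↔ ∃ R, PropSub X R ∧ x ∈ R ∧ y ∈ R := by
  constructor
  · rintro ⟨R, ⟨h1, h2, h3, h4⟩, h5⟩
    exact ⟨R, ⟨h1, h2, h3⟩, h4, h5⟩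
  · rintro ⟨R, ⟨h1, h2, h3⟩, h4, h5⟩
    exact ⟨R, ⟨h1, h2, h3, h4⟩, h5⟩

lemma composant_subset {X : Set ℂ} {x : ℂ} : Composant X x ⊆ X := by
  intro y hy
  obtain ⟨R, hR, -, h⟩ := mem_composant_iff.1 hy
  exact hR.2.1 h

lemma self_mem_composant {X : Set ℂ} (hX : IndecomposableC X) {x : ℂ} (hx : x ∈ X) :
    x ∈ Composant X x := by
  refine mem_composant_iff.2 ⟨{x}, ⟨⟨isCompact_singleton, isConnected_singleton⟩,
    by simpa using hx, fun h => ?_⟩, rfl, rfl⟩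
  have := hX.2.1
  rw [← h] at this
  exact Set.not_nontrivial_singleton this

lemma propSub_union {X A B : Set ℂ} (hX : IndecomposableC X) (hA : PropSub X A)
    (hB : PropSub X B) (h : (A ∩ B).Nonempty) : PropSub X (A ∪ B) :=
  ⟨⟨hA.1.1.union hB.1.1, IsConnected.union h hA.1.2 hB.1.2⟩, union_subset hA.2.1 hB.2.1,
    fun he => hX.2.2 ⟨A, B, hA.1, hB.1, hA.2.1, hB.2.1, hA.2.2, hB.2.2, he⟩⟩

lemma composant_symm {X : Set ℂ} {x y : ℂ} (h : y ∈ Composant X x) : x ∈ Composant X y := by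
  obtain ⟨R, hR, h1, h2⟩ := mem_composant_iff.1 h
  exact mem_composant_iff.2 ⟨R, hR, h2, h1⟩

lemma composant_trans {X : Set ℂ} (hX : IndecomposableC X) {x y z : ℂ} (h : y ∈ Composant X x)
    (h' : z ∈ Composant X y) : z ∈ Composant X x := by
  obtain ⟨R, hR, h1, h2⟩ := mem_composant_iff.1 h
  obtain ⟨S, hS, h3, h4⟩ := mem_composant_iff.1 h'
  exact mem_composant_iff.2 ⟨R ∪ S, propSub_union hX hR hS ⟨y, h2, h3⟩, Or.inl h1, Or.inr h4⟩

lemma composant_preconnected {X : Set ℂ} {x : ℂ} : IsPreconnected (Composant X x) :=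
  isPreconnected_sUnion x _ (fun _ h => h.2.2.2) fun _ h => h.1.2.2

lemma composant_dense {X : Set ℂ} (hX : IndecomposableC X) {x : ℂ} (hx : x ∈ X) :
    X ⊆ closure (Composant X x) := by
  by_contra hns
  obtain ⟨q, hqX, hq⟩ := not_subset.1 hns
  set M := closure (Composant X x) with hM
  have hXc := hX.1.1
  have hxM : x ∈ M := subset_closure (self_mem_composant hX hx)
  have hMX : M ⊆ X := closure_minimal composant_subset hXc.isClosed
  have hMc : IsCompact M := hXc.of_isClosed_subset isClosed_closure hMX
  obtain ⟨U, V, hU, hV, hqU, hMV, hUV⟩ : SeparatedNhds {q} M :=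
    SeparatedNhds.of_isCompact_isCompact isCompact_singleton hMc (by simpa using hq)
  have hqU : q ∈ U := hqU rfl
  have hUV' : ∀ z ∈ U, z ∉ V := Set.disjoint_left.1 hUV
  set N := X \ U with hN
  have hNcl : IsClosed N := hXc.isClosed.sdiff hU
  have hNc : IsCompact N := hXc.of_isClosed_subset hNcl sdiff_subset
  have hxN : x ∈ N := ⟨hx, fun h => hUV' x h (hMV hxM)⟩
  have hKM : connectedComponentIn N x ⊆ V := by
    refine Subset.trans ?_ hMV
    have hKN : connectedComponentIn N x ⊆ N := connectedComponentIn_subset _ _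
    intro z hz
    refine subset_closure (mem_composant_iff.2 ⟨connectedComponentIn N x, ⟨⟨?_, ?_⟩, ?_, ?_⟩,
      mem_connectedComponentIn hxN, hz⟩)
    · exact hNc.of_isClosed_subset (isClosed_compIn hNcl x) hKN
    · exact ⟨⟨z, hz⟩, isPreconnected_connectedComponentIn⟩
    · exact hKN.trans sdiff_subset
    · intro h
      exact (hKN (h.symm.subset hqX)).2 hqU
  have : CompactSpace N := isCompact_iff_compactSpace.1 hNc
  obtain ⟨F, hF, hxF, hFV⟩ : ∃ F : Set N, IsClopen F ∧ (⟨x, hxN⟩ : N) ∈ F ∧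
      F ⊆ Subtype.val ⁻¹' V := by
    have hdir : Directed (· ⊇ ·)
        (fun s : { s : Set N // IsClopen s ∧ (⟨x, hxN⟩ : N) ∈ s } => (s : Set N)) := by
      intro s t
      exact ⟨⟨s ∩ t, s.2.1.inter t.2.1, s.2.2, t.2.2⟩, inter_subset_left, inter_subset_right⟩
    have hne : Nonempty { s : Set N // IsClopen s ∧ (⟨x, hxN⟩ : N) ∈ s } :=
      ⟨⟨univ, isClopen_univ, mem_univ _⟩⟩
    obtain ⟨s, hs⟩ := exists_subset_nhds_of_compactSpace hdir (fun s => s.2.1.1)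
      (U := Subtype.val ⁻¹' V) (by
        intro z hz
        rw [← connectedComponent_eq_iInter_isClopen] at hz
        refine (hV.preimage continuous_subtype_val).mem_nhds (hKM ?_)
        rw [connectedComponentIn_eq_image hxN]
        exact mem_image_of_mem _ hz)
    exact ⟨s, s.2.1, s.2.2, hs⟩
  have hF1 : IsClosed (Subtype.val '' F) := hNcl.isClosedEmbedding_subtypeVal.isClosedMap _ hF.1
  have hF2 : IsClosed (Subtype.val '' Fᶜ) :=
    hNcl.isClosedEmbedding_subtypeVal.isClosedMap _ hF.compl.1
  obtain ⟨z, hzX, ⟨⟨z', hzN⟩, hzF, rfl⟩, h2⟩ := isPreconnected_closed_iff.1 hX.1.2.2 _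
    (Subtype.val '' Fᶜ ∪ X ∩ Vᶜ) hF1
    (hF2.union (hXc.isClosed.inter hV.isClosed_compl)) (by
      intro z hz
      by_cases hzV : z ∈ V
      · have hzN : z ∈ N := ⟨hz, fun h => hUV' z h hzV⟩
        by_cases hzF : (⟨z, hzN⟩ : N) ∈ F
        · exact Or.inl ⟨_, hzF, rfl⟩
        · exact Or.inr (Or.inl ⟨_, hzF, rfl⟩)
      · exact Or.inr (Or.inr ⟨hz, hzV⟩)) ⟨x, hx, _, hxF, rfl⟩
      ⟨q, hqX, Or.inr ⟨hqX, hUV' q hqU⟩⟩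
  rcases h2 with ⟨w, hw, hwz⟩ | h2
  · have : w = ⟨z', hzN⟩ := Subtype.ext hwz
    exact hw (this ▸ hzF)
  · exact h2.2 (hFV hzF)

lemma not_countable_cover {X : Set ℂ} (hX : IndecomposableC X) {F : Set (Set ℂ)}
    (hF : F.Countable) (hp : ∀ R ∈ F, PropSub X R) : ¬ X ⊆ ⋃₀ F := by
  intro hcov
  have hXc := hX.1.1
  have : CompactSpace X := isCompact_iff_compactSpace.1 hXc
  have : Nonempty X := hX.1.2.nonempty.to_subtype
  have : Countable F := hF.to_subtype
  obtain ⟨R, p, hp1⟩ := nonempty_interior_of_iUnion_of_closed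
    (f := fun R : F => (Subtype.val ⁻¹' (R : Set ℂ) : Set X))
    (fun R => (hp R R.2).1.1.isClosed.preimage continuous_subtype_val) (by
      rw [eq_univ_iff_forall]
      intro z
      obtain ⟨R, hR, hz⟩ := hcov z.2
      exact mem_iUnion.2 ⟨⟨R, hR⟩, hz⟩)
  obtain ⟨G, hG, hGe⟩ := isOpen_induced_iff.1 (isOpen_interior (s := (Subtype.val ⁻¹' (R : Set ℂ) : Set X)))
  have hpG : (p : ℂ) ∈ G := by
    have : p ∈ Subtype.val ⁻¹' G := hGe ▸ hp1
    exact this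
  obtain ⟨w, hwG, hwX, hwR⟩ := mem_closure_iff.1 (indec_dense_compl hX (hp R R.2) p.2) G hG hpG
  have : (⟨w, hwX⟩ : X) ∈ Subtype.val ⁻¹' G := hwG
  rw [hGe] at this
  have h3 : (⟨w, hwX⟩ : X) ∈ (Subtype.val ⁻¹' (R : Set ℂ) : Set X) := interior_subset this
  exact hwR h3

lemma composant_countable {X : Set ℂ} (hX : IndecomposableC X) {x : ℂ} (hx : x ∈ X) :
    ∃ F : Set (Set ℂ), F.Countable ∧ (∀ R ∈ F, PropSub X R) ∧ Composant X x ⊆ ⋃₀ F := by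
  have hXc := hX.1.1
  refine ⟨(fun V => connectedComponentIn (X \ V) x) ''
    {V ∈ TopologicalSpace.countableBasis ℂ | x ∉ V ∧ (X ∩ V).Nonempty},
    ((TopologicalSpace.countable_countableBasis ℂ).mono fun V h => h.1).image _, ?_, ?_⟩
  · rintro _ ⟨V, ⟨hV, hxV, w, hwX, hwV⟩, rfl⟩
    have hVo := TopologicalSpace.isOpen_of_mem_countableBasis hV
    have hcl : IsClosed (X \ V) := hXc.isClosed.sdiff hVo
    have hsub : connectedComponentIn (X \ V) x ⊆ X \ V := connectedComponentIn_subset _ _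
    refine ⟨⟨hXc.of_isClosed_subset (isClosed_compIn hcl x) (hsub.trans sdiff_subset),
      ⟨x, mem_connectedComponentIn ⟨hx, hxV⟩⟩, isPreconnected_connectedComponentIn⟩,
      hsub.trans sdiff_subset, fun h => ?_⟩
    have h2 : w ∈ connectedComponentIn (X \ V) x := by simpa only [h] using hwX
    exact (hsub h2).2 hwV
  · intro y hy
    obtain ⟨R, hR, hxR, hyR⟩ := mem_composant_iff.1 hy
    obtain ⟨q, hqX, hqR⟩ : ∃ q ∈ X, q ∉ R := by
      by_contra h
      push Not at h
      exact hR.2.2 (subset_antisymm hR.2.1 h)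
    obtain ⟨V, hV, hqV, hVR⟩ := (TopologicalSpace.isBasis_countableBasis ℂ).exists_subset_of_mem_open
      (show q ∈ Rᶜ from hqR) hR.1.1.isClosed.isOpen_compl
    refine ⟨_, ⟨V, ⟨hV, fun h => hVR h hxR, q, hqX, hqV⟩, rfl⟩, ?_⟩
    have hRV : R ⊆ X \ V := fun z hz => ⟨hR.2.1 hz, fun h => hVR h hz⟩
    exact hR.1.2.2.subset_connectedComponentIn hxR hRV hyR

lemma not_countable_composants {X : Set ℂ} (hX : IndecomposableC X) {T : Set ℂ}
    (hT : T.Countable) (hTX : T ⊆ X) : ¬ X ⊆ ⋃ x ∈ T, Composant X x := by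
  have h : ∀ x, ∃ F : Set (Set ℂ), x ∈ T → F.Countable ∧ (∀ R ∈ F, PropSub X R) ∧
      Composant X x ⊆ ⋃₀ F := by
    intro x
    by_cases hx : x ∈ T
    · obtain ⟨F, hF⟩ := composant_countable hX (hTX hx)
      exact ⟨F, fun _ => hF⟩
    · exact ⟨∅, fun h => (hx h).elim⟩
  choose F hF using h
  intro hcov
  refine not_countable_cover hX (F := ⋃ x ∈ T, F x) (hT.biUnion fun x hx => (hF x hx).1) ?_ ?_
  · intro R hR
    simp only [mem_iUnion] at hR
    obtain ⟨x, hx, hR⟩ := hR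
    exact (hF x hx).2.1 R hR
  · intro z hz
    have h := hcov hz
    simp only [mem_iUnion] at h
    obtain ⟨x, hx, h⟩ := h
    obtain ⟨R, hR, hzR⟩ := (hF x hx).2.2 h
    exact ⟨R, mem_biUnion hx hR, hzR⟩

lemma theorem_P {X Y O : Set ℂ} {o : ℂ} (hX : IndecomposableC X) (hY : IsContinuum Y)
    (hO : IsPreconnected O) (ho : o ∈ O) (hOb : IsBounded Oᶜ) (hOY : Disjoint O Y)
    (hOX : Disjoint O X) (hXO : X ⊆ closure O) (hXY : ¬ X ⊆ Y) {G : Set ℂ} (hG : IsOpen G)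
    (hGX : (G ∩ X).Nonempty) (hGY : G ∩ X ⊆ Y) : False := by
  have hXc := hX.1.1
  have hYcl := hY.1.isClosed
  have step : ∀ x ∈ X, ∃ R, PropSub X R ∧ R ⊆ Composant X x ∧ ¬ IsPreconnected (R ∩ Y) := by
    intro x hx
    by_contra hcon
    push Not at hcon
    obtain ⟨g, hgG, hgX⟩ := hGX
    obtain ⟨w', hwG, hwW⟩ := mem_closure_iff.1 (composant_dense hX hx hgX) G hG hgG
    have hwX : w' ∈ X := composant_subset hwW
    have hwY : w' ∈ Y := hGY ⟨hwG, hwX⟩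
    have hpre : IsPreconnected (Composant X x ∩ Y) := by
      refine isPreconnected_of_forall w' ?_
      rintro y ⟨hyW, hyY⟩
      obtain ⟨R, hR, h1, h2⟩ := mem_composant_iff.1 (composant_trans hX (composant_symm hwW) hyW)
      have hRW : R ⊆ Composant X x := fun z hz =>
        composant_trans hX hwW (mem_composant_iff.2 ⟨R, hR, h1, hz⟩)
      exact ⟨R ∩ Y, inter_subset_inter_left _ hRW, ⟨h1, hwY⟩, ⟨h2, hyY⟩, hcon R hR hRW⟩
    set M := closure (Composant X x ∩ Y) with hM
    have hMX : M ⊆ X := closure_minimal (inter_subset_left.trans composant_subset) hXc.isClosed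
    have hMY : M ⊆ Y := closure_minimal inter_subset_right hYcl
    have hMp : PropSub X M :=
      ⟨⟨hXc.of_isClosed_subset isClosed_closure hMX, ⟨w', subset_closure ⟨hwW, hwY⟩⟩, hpre.closure⟩,
        hMX, fun h => hXY (h ▸ hMY)⟩
    obtain ⟨w, hwG2, hwX2, hwM⟩ := mem_closure_iff.1 (indec_dense_compl hX hMp hwX) G hG hwG
    obtain ⟨v, ⟨hvG, hvM⟩, hvW⟩ := mem_closure_iff.1 (composant_dense hX hx hwX2) (G ∩ Mᶜ)
      (hG.inter isClosed_closure.isOpen_compl) ⟨hwG2, hwM⟩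
    exact hvM (subset_closure ⟨hvW, hGY ⟨hvG, composant_subset hvW⟩⟩)
  have step' : ∀ W : Set ℂ, ∃ x : ℂ, ∃ R : Set ℂ, IsComposant X W →
      x ∈ X ∧ W = Composant X x ∧ PropSub X R ∧ R ⊆ W ∧ ¬ IsPreconnected (R ∩ Y) := by
    intro W
    by_cases hW : IsComposant X W
    · obtain ⟨x, hx, rfl⟩ := hW
      obtain ⟨R, h1, h2, h3⟩ := step x hx
      exact ⟨x, R, fun _ => ⟨hx, rfl, h1, h2, h3⟩⟩
    · exact ⟨0, ∅, fun h => (hW h).elim⟩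
  choose x R hxR using step'
  have hcount : {W | IsComposant X W}.Countable := by
    refine Set.PairwiseDisjoint.countable_of_isOpen (s := fun W => cutOff Y o (R W)) ?_ ?_ ?_
    · intro W₁ h₁ W₂ h₂ hne
      obtain ⟨hx1, e1, hR1, hs1, -⟩ := hxR W₁ h₁
      obtain ⟨hx2, e2, hR2, hs2, -⟩ := hxR W₂ h₂
      refine cutOff_disjoint hYcl hR1.1.1.isClosed hR2.1.1.isClosed hO ho hOY
        (hOX.mono_right hR1.2.1) (hOX.mono_right hR2.2.1) (hR1.2.1.trans hXO) (hR2.2.1.trans hXO) ?_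
      rw [Set.disjoint_left]
      intro z hz1 hz2
      apply hne
      have m1 : z ∈ Composant X (x W₁) := e1 ▸ hs1 hz1
      have m2 : z ∈ Composant X (x W₂) := e2 ▸ hs2 hz2
      rw [e1, e2]
      ext y
      exact ⟨fun h => composant_trans hX m2 (composant_trans hX (composant_symm m1) h),
        fun h => composant_trans hX m1 (composant_trans hX (composant_symm m2) h)⟩
    · intro W hW
      exact cutOff_isOpen hYcl (hxR W hW).2.2.1.1.1.isClosed
    · intro W hW
      obtain ⟨hx1, e1, hR1, hs1, hn⟩ := hxR W hW
      exact cutOff_nonempty hYcl hY.2 hR1.1.1 hR1.1.2.2 hO ho hOb hOY (hR1.2.1.trans hXO) hn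
  refine not_countable_composants hX (hcount.image x) ?_ ?_
  · rintro _ ⟨W, hW, rfl⟩
    exact (hxR W hW).1
  · intro z hz
    have hW : IsComposant X (Composant X z) := ⟨z, hz, rfl⟩
    refine mem_biUnion (mem_image_of_mem x hW) ?_
    rw [← (hxR _ hW).2.1]
    exact self_mem_composant hX hz

lemma exterior_preconnected {r : ℝ} (hr : 0 < r) : IsPreconnected {z : ℂ | r < ‖z‖} := by
  have e : {z : ℂ | r < ‖z‖} = Complex.exp '' {w : ℂ | Real.log r < w.re} := by
    ext z
    constructor
    · intro hz
      have hz0 : z ≠ 0 := by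
        rintro rfl
        simp at hz
        linarith
      refine ⟨Complex.log z, ?_, Complex.exp_log hz0⟩
      simp only [mem_ofPred_eq, Complex.log_re]
      exact Real.log_lt_log hr hz
    · rintro ⟨w, hw, rfl⟩
      simp only [mem_ofPred_eq, Complex.norm_exp]
      exact (Real.log_lt_iff_lt_exp hr).1 hw
  rw [e]
  exact (convex_halfSpace_re_gt _).isPreconnected.image _ Complex.continuous_exp.continuousOn

lemma exterior_mem {r : ℝ} (hr : 0 < r) : ((r + 1 : ℝ) : ℂ) ∈ {z : ℂ | r < ‖z‖} := by
  simp only [mem_ofPred_eq, Complex.norm_real, Real.norm_eq_abs]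
  rw [abs_of_pos (by linarith)]
  linarith

lemma exterior_not_bounded {r : ℝ} : ¬ IsBounded {z : ℂ | r < ‖z‖} := by
  intro h
  obtain ⟨s, hs⟩ := h.subset_closedBall 0
  have h1 : ((max r s + 1 + |r| + |s| : ℝ) : ℂ) ∈ {z : ℂ | max r s < ‖z‖} := by
    simp only [mem_ofPred_eq, Complex.norm_real, Real.norm_eq_abs]
    refine lt_of_lt_of_le ?_ (le_abs_self _)
    linarith [abs_nonneg r, abs_nonneg s]
  have h2 := hs (lt_of_le_of_lt (le_max_left r s) h1)
  rw [mem_closedBall_zero_iff] at h2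
  exact absurd (lt_of_le_of_lt (le_max_right r s) h1) (not_lt.2 h2)

lemma exterior_subset_comp {S : Set ℂ} {r : ℝ} (hr : 0 < r) (hS : {z : ℂ | r < ‖z‖} ⊆ S) {x : ℂ}
    (hx : ¬ IsBounded (connectedComponentIn S x)) :
    {z : ℂ | r < ‖z‖} ⊆ connectedComponentIn S x := by
  obtain ⟨z, hz, hzr⟩ : ∃ z ∈ connectedComponentIn S x, r < ‖z‖ := by
    by_contra h
    push Not at h
    exact hx (Metric.isBounded_closedBall.subset (t := Metric.closedBall 0 r)
      fun z hz => mem_closedBall_zero_iff.2 (h z hz))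
  rw [connectedComponentIn_eq hz]
  exact (exterior_preconnected hr).subset_connectedComponentIn hzr hS

lemma exists_exterior {K : Set ℂ} (hK : IsBounded K) :
    ∃ r : ℝ, 0 < r ∧ {z : ℂ | r < ‖z‖} ⊆ Kᶜ := by
  obtain ⟨r, hr⟩ := hK.subset_closedBall 0
  refine ⟨max r 1, by positivity, fun z hz hzK => ?_⟩
  have := hr hzK
  rw [mem_closedBall_zero_iff] at this
  exact absurd (lt_of_le_of_lt (le_max_left r 1) hz) (not_lt.2 this)

lemma outer_props {X : Set ℂ} (hX : IsCompact X) :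
    IsOpen (hullC X)ᶜ ∧ IsPreconnected (hullC X)ᶜ ∧ IsBounded (hullC X) ∧ X ⊆ hullC X := by
  obtain ⟨r, hr, hrX⟩ := exists_exterior hX.isBounded
  set e : ℂ := ((r + 1 : ℝ) : ℂ) with he
  have hee := exterior_mem hr
  have hE : {z : ℂ | r < ‖z‖} ⊆ connectedComponentIn Xᶜ e :=
    (exterior_preconnected hr).subset_connectedComponentIn hee hrX
  have hun : ¬ IsBounded (connectedComponentIn Xᶜ e) := fun h => exterior_not_bounded (h.subset hE)
  have heq : (hullC X)ᶜ = connectedComponentIn Xᶜ e := by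
    ext z
    constructor
    · intro hz
      have hz' : ¬ IsBounded (connectedComponentIn Xᶜ z) := hz
      have h1 := exterior_subset_comp hr hrX hz' hee
      rw [← connectedComponentIn_eq h1]
      apply mem_connectedComponentIn
      intro hzX
      apply hz'
      rw [connectedComponentIn_eq_empty (by simpa using hzX)]
      exact isBounded_empty
    · intro hz h
      have h' : IsBounded (connectedComponentIn Xᶜ z) := h
      rw [← connectedComponentIn_eq hz] at h'
      exact hun h'
  refine ⟨heq ▸ hX.isClosed.isOpen_compl.connectedComponentIn,
    heq ▸ isPreconnected_connectedComponentIn, ?_, ?_⟩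
  · refine Metric.isBounded_closedBall.subset (t := Metric.closedBall 0 r) fun z hz => ?_
    rw [mem_closedBall_zero_iff]
    by_contra h
    have h2 : z ∈ (hullC X)ᶜ := heq ▸ hE (not_le.1 h)
    exact h2 hz
  · intro z hz
    show IsBounded (connectedComponentIn Xᶜ z)
    rw [connectedComponentIn_eq_empty (by simpa using hz)]
    exact isBounded_empty

lemma preimage_outer {f : ℂ → ℂ} (hf : Continuous f) (hopen : IsOpenMap f)
    (hperfect : ∀ K : Set ℂ, IsCompact K → IsCompact (f ⁻¹' K)) {U : Set ℂ} (hU : IsOpen U)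
    (hUp : IsPreconnected U) (hUb : IsBounded Uᶜ) :
    IsPreconnected (f ⁻¹' U) ∧ IsBounded (f ⁻¹' U)ᶜ := by
  have hUc : IsCompact Uᶜ := Metric.isCompact_of_isClosed_isBounded hU.isClosed_compl hUb
  have hOc : IsCompact (f ⁻¹' U)ᶜ := by
    rw [← preimage_compl]; exact hperfect _ hUc
  have hUun : ¬ IsBounded U := by
    intro h
    obtain ⟨r, hr, hrU⟩ := exists_exterior hUb
    rw [compl_compl] at hrU
    exact exterior_not_bounded (h.subset hrU)
  refine ⟨?_, hOc.isBounded⟩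
  obtain ⟨r, hr, hrO⟩ := exists_exterior hOc.isBounded
  rw [compl_compl] at hrO
  set O := f ⁻¹' U with hOdef
  have hO : IsOpen O := hU.preimage hf
  have hcomp : ∀ x ∈ O, ¬ IsBounded (connectedComponentIn O x) := by
    intro x hx hb
    set C := connectedComponentIn O x with hC
    have hCo : IsOpen C := hO.connectedComponentIn
    have hxC : x ∈ C := mem_connectedComponentIn hx
    have hclC : IsCompact (closure C) := hb.isCompact_closure
    have hcl2 : IsCompact (f '' closure C) := hclC.image hf
    have hsub := subset_of_frontier hUp (hopen C hCo) (by
      intro z hz hzf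
      have h1 : z ∈ f '' closure C :=
        closure_minimal (image_mono subset_closure) hcl2.isClosed (frontier_subset_closure hzf)
      obtain ⟨w, hw, rfl⟩ := h1
      have hwC : w ∉ C := by
        intro hwC
        have := (hopen C hCo).inter_frontier_eq
        have h3 : f w ∈ (∅ : Set ℂ) := this ▸ ⟨mem_image_of_mem f hwC, hzf⟩
        exact h3
      have hwf : w ∈ frontier C := ⟨hw, by rwa [hCo.interior_eq]⟩
      have h4 := frontier_comp_subset (T := Oᶜ) hO.isClosed_compl x
      rw [compl_compl] at h4
      exact h4 hwf hz) ⟨f x, hx, mem_image_of_mem f hxC⟩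
    exact hUun (hcl2.isBounded.subset (hsub.trans (image_mono subset_closure)))
  have hee := exterior_mem hr
  have heq : O = connectedComponentIn O ((r + 1 : ℝ) : ℂ) := by
    refine subset_antisymm (fun z hz => ?_) (connectedComponentIn_subset _ _)
    have := exterior_subset_comp hr hrO (hcomp z hz) hee
    rw [← connectedComponentIn_eq this]
    exact mem_connectedComponentIn hz
  rw [heq]
  exact isPreconnected_connectedComponentIn

theorem intersection_with_sibling_in_external_composants
    (f τ : ℂ → ℂ) (c : ℂ)
    (hf : Continuous f) (hopen : IsOpenMap f)
    (hperfect : ∀ K : Set ℂ, IsCompact K → IsCompact (f ⁻¹' K))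
    (hτ : Continuous τ) (hττ : ∀ x, τ (τ x) = x) (hfτ : ∀ x, f (τ x) = f x)
    (hfib : ∀ x y, f x = f y → y = x ∨ y = τ x)
    (hc : τ c = c) (hcuniq : ∀ x, τ x = x → x = c)
    (hconf : Confluent f)
    (X : Set ℂ) (hX : IndecomposableC X) (hXu : Unshielded X) (hfX : f '' X = X)
    (hmeet : (X ∩ τ '' X).Nonempty) (hnsub : ¬ τ '' X ⊆ X) :
    X ∩ τ '' X ⊆ ExternalUnion X ∧
    (X ∩ τ '' X).Nonempty ∧
    X ∩ τ '' X ≠ X ∧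
    IsClosed (X ∩ τ '' X) ∧
    interior (Subtype.val ⁻¹' (X ∩ τ '' X) : Set X) = ∅ := by
  have hXc := hX.1.1
  have himg : ∀ {g : ℂ → ℂ} {K : Set ℂ}, Continuous g → IsContinuum K → IsContinuum (g '' K) :=
    fun hg hK => ⟨hK.1.image hg, hK.2.image _ hg.continuousOn⟩
  have hY : IsContinuum (τ '' X) := himg hτ hX.1
  have hXY : ¬ X ⊆ τ '' X := by
    intro h
    apply hnsub
    rintro _ ⟨x, hx, rfl⟩
    obtain ⟨x', hx', rfl⟩ := h hx
    rwa [hττ]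
  have hfmem : ∀ x ∈ X, f x ∈ X := fun x hx => hfX ▸ mem_image_of_mem f hx
  have lemD : ∀ R, PropSub X R → PropSub X (f '' R) := by
    intro R hR
    refine ⟨himg hf hR.1, by rintro _ ⟨x, hx, rfl⟩; exact hfmem x (hR.2.1 hx), fun he => ?_⟩
    have hsub : X \ R ⊆ τ '' R := by
      rintro z ⟨hz, hzR⟩
      obtain ⟨r, hr, hrz⟩ := he.symm.subset (hfmem z hz)
      rcases hfib r z hrz with rfl | rfl
      · exact (hzR hr).elim
      · exact mem_image_of_mem τ hr
    exact hXY ((indec_dense_compl hX hR).trans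
      ((closure_minimal hsub (himg hτ hR.1).1.isClosed).trans (image_mono hR.2.1)))
  refine ⟨?_, hmeet, fun h => hXY (fun z hz => (h.symm.subset hz).2),
    hXc.isClosed.inter hY.1.isClosed, ?_⟩
  · rintro y ⟨hyX, hyY⟩
    have hτy : τ y ∈ X := by
      obtain ⟨x, hx, rfl⟩ := hyY
      rwa [hττ]
    refine ⟨Composant X y, ⟨y, hyX, rfl⟩, fun hInternal => ?_, self_mem_composant hX hyX⟩
    obtain ⟨Q, hQ, hyQ, hQX⟩ : ∃ Q, PropSub X Q ∧ τ y ∈ Q ∧ ¬ τ '' Q ⊆ X := by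
      by_contra hcon
      push Not at hcon
      apply hnsub
      rintro _ ⟨x, hx, rfl⟩
      have h1 : Composant X (τ y) ⊆ τ ⁻¹' X := by
        intro z hz
        obtain ⟨R, hR, h1, h2⟩ := mem_composant_iff.1 hz
        exact hcon R hR h1 (mem_image_of_mem τ h2)
      exact closure_minimal h1 (hXc.isClosed.preimage hτ) (composant_dense hX hτy hx)
    obtain ⟨q, hqQ, hqX⟩ := not_subset.1 hQX
    have hyL : y ∈ τ '' Q := ⟨τ y, hyQ, hττ y⟩
    have hmeets := hInternal.2 (τ '' Q) (himg hτ hQ.1) ⟨q, hqQ, hqX⟩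
      ⟨y, hyL, self_mem_composant hX hyX⟩
    have hfyX := hfmem y hyX
    refine not_countable_composants hX (T := {f y}) (countable_singleton _)
      (by simpa using hfyX) ?_
    intro z hz
    obtain ⟨x, hx, rfl⟩ := hfX.symm.subset hz
    obtain ⟨p, ⟨p', hp', rfl⟩, hpW⟩ := hmeets (Composant X x) ⟨x, hx, rfl⟩
    obtain ⟨R, hR, hxR, hpR⟩ := mem_composant_iff.1 hpW
    have h1 : f p' ∈ Composant X (f y) := mem_composant_iff.2 ⟨f '' Q, lemD Q hQ,
      by rw [← hfτ]; exact mem_image_of_mem f hyQ, mem_image_of_mem f hp'⟩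
    have h2 : f x ∈ Composant X (f p') := mem_composant_iff.2 ⟨f '' R, lemD R hR,
      by rw [← hfτ]; exact mem_image_of_mem f hpR, mem_image_of_mem f hxR⟩
    simpa using composant_trans hX h1 h2
  · obtain ⟨hUo, hUp, hUb, hXh⟩ := outer_props hXc
    obtain ⟨hOp, hOb⟩ := preimage_outer hf hopen hperfect hUo hUp (by rwa [compl_compl])
    have hXcl : X ⊆ closure (hullC X)ᶜ := by
      have : X = frontier (hullC X)ᶜ := hXu
      intro z hz
      exact frontier_subset_closure (this.subset hz)
    obtain ⟨r, hr, hrO⟩ := exists_exterior hOb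
    rw [compl_compl] at hrO
    rw [eq_empty_iff_forall_notMem]
    intro p hp
    obtain ⟨G, hG, hGe⟩ := isOpen_induced_iff.1
      (isOpen_interior (s := (Subtype.val ⁻¹' (X ∩ τ '' X) : Set X)))
    have hpG : (p : ℂ) ∈ G := by
      have : p ∈ Subtype.val ⁻¹' G := hGe ▸ hp
      exact this
    refine theorem_P hX hY hOp (hrO (exterior_mem hr)) hOb ?_ ?_ ?_ hXY hG ⟨p, hpG, p.2⟩ ?_
    · rw [Set.disjoint_left]
      rintro z hz ⟨x, hx, rfl⟩
      apply hz
      rw [hfτ]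
      exact hXh (hfmem x hx)
    · rw [Set.disjoint_left]
      intro z hz hx
      exact hz (hXh (hfmem z hx))
    · intro z hz
      exact hopen.preimage_closure_subset_closure_preimage (hXcl (hfmem z hz))
    · rintro z ⟨hzG, hzX⟩
      have : (⟨z, hzX⟩ : X) ∈ Subtype.val ⁻¹' G := hzG
      rw [hGe] at this
      have h3 : (⟨z, hzX⟩ : X) ∈ (Subtype.val ⁻¹' (X ∩ τ '' X) : Set X) := interior_subset this
      exact h3.2
end
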